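/- arXiv:1801.00034 — 11 statements merged into one kernel-verified Lean document; each statement's English description precedes it below -/
import Mathlib

section
/- There exists exactly one continuous function G : ℝ → ℝ such that for every x ∈ ℝ the function y ↦ (1 + G(y))·exp(−G(y)) is integrable on the interval (−x, ∞) and G(x) = ∫_{−x}^∞ (1 + G(y))·exp(−G(y)) dy. -/
open Real MeasureTheory Set

open Filter Topology NNReal

/-- A bounded, globally Lipschitz autonomous vector field on a Banach space admits a global
integral curve through every point. -/
theorem exists_global_integralCurve {E : Type*} [NormedAddCommGroup E] [NormedSpace ℝ E]
    [CompleteSpace E] {v : E → E} {K L : ℝ≥0} (hv : LipschitzWith K v) (hL : ∀ x, ‖v x‖ ≤ L)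
    (x₀ : E) : ∃ γ : ℝ → E, γ 0 = x₀ ∧ ∀ t, HasDerivAt γ (v (γ t)) t := by
  have hloc : ∀ T : ℝ≥0, ∃ γ : ℝ → E, γ 0 = x₀ ∧
      ∀ t ∈ Ioo (-T : ℝ) T, HasDerivAt γ (v (γ t)) t := by
    intro T
    have hPL : IsPicardLindelof (fun _ ↦ v) (tmin := -T) (tmax := T) ⟨0, by simp⟩ x₀
        (L * T) 0 L K :=
      .of_time_independent (fun x _ ↦ hL x) hv.lipschitzOnWith (by simp)
    obtain ⟨γ, hγ₀, hγ⟩ := hPL.exists_eq_forall_mem_Icc_hasDerivWithinAt₀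
    exact ⟨γ, hγ₀, fun t ht ↦ (hγ t (Ioo_subset_Icc_self ht)).hasDerivAt (Icc_mem_nhds ht.1 ht.2)⟩
  choose γ hγ₀ hγ using hloc
  have hglue : ∀ S T : ℝ≥0, S ≤ T → EqOn (γ S) (γ T) (Ioo (-S : ℝ) S) := by
    intro S T hST t ht
    have hST' : (S : ℝ) ≤ T := hST
    have hS : (0 : ℝ) < S := by linarith [ht.1, ht.2]
    exact ODE_solution_unique_of_mem_Ioo (v := fun _ ↦ v) (s := fun _ ↦ univ) (t₀ := 0) (K := K)
      (fun _ _ ↦ hv.lipschitzOnWith) ⟨by linarith, hS⟩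
      (fun s hs ↦ ⟨hγ S s hs, mem_univ _⟩)
      (fun s hs ↦ ⟨hγ T s ⟨by linarith [hs.1], by linarith [hs.2]⟩, mem_univ _⟩)
      (by rw [hγ₀, hγ₀]) ht
  have hmem : ∀ t : ℝ, t ∈ Ioo (-(‖t‖₊ + 1 : ℝ≥0) : ℝ) (‖t‖₊ + 1 : ℝ≥0) := by
    intro t
    have : |t| < |t| + 1 := lt_add_one _
    simpa using abs_lt.mp this
  refine ⟨fun t ↦ γ (‖t‖₊ + 1) t, hγ₀ _, fun t ↦ ?_⟩
  refine (hγ _ t (hmem t)).congr_of_eventuallyEq ?_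
  filter_upwards [Ioo_mem_nhds (hmem t).1 (hmem t).2] with s hs
  rcases le_total (‖s‖₊ + 1) (‖t‖₊ + 1) with h | h
  · exact hglue _ _ h (hmem s)
  · exact (hglue _ _ h hs).symm

/-- A function whose derivative is eventually bounded below by a positive constant tends to
infinity. -/
theorem tendsto_atTop_of_le_hasDerivAt {f f' : ℝ → ℝ} (hf : ∀ x, HasDerivAt f (f' x) x) {c : ℝ}
    (hc : 0 < c) (h : ∀ᶠ x in atTop, c ≤ f' x) : Tendsto f atTop atTop := by
  obtain ⟨N, hN⟩ := eventually_atTop.mp h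
  have hlin : Tendsto (fun x : ℝ ↦ f N + c * (x - N)) atTop atTop :=
    tendsto_atTop_add_const_left _ _
      ((tendsto_atTop_add_const_right _ (-N) tendsto_id).const_mul_atTop hc)
  refine tendsto_atTop_mono' _ ?_ hlin
  filter_upwards [eventually_ge_atTop N] with x hx
  have := (convex_Ici N).mul_sub_le_image_sub_of_le_deriv (f := f) (C := c)
    (fun y _ ↦ (hf y).continuousAt.continuousWithinAt)
    (fun y _ ↦ (hf y).differentiableAt.differentiableWithinAt)
    (fun y hy ↦ by rw [(hf y).deriv]; exact hN y (interior_subset hy)) N self_mem_Ici x hx hx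
  linarith

section Reflected

variable {W P G : ℝ → ℝ}

theorem hasDerivAt_comp_neg_of_reflected (hG : ∀ x, HasDerivAt G (W (G (-x))) x) (x : ℝ) :
    HasDerivAt (fun y ↦ G (-y)) (-W (G x)) x := by
  exact ((hG (-x)).scomp x (hasDerivAt_neg x)).congr_deriv (by simp)

/-- The reflected equation `G' x = W (G (-x))` has `P (G x) + P (G (-x))` as a first integral when
`P' = -W`. -/
theorem reflected_first_integral (hP : ∀ g, HasDerivAt P (-W g) g)
    (hG : ∀ x, HasDerivAt G (W (G (-x))) x) (x y : ℝ) :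
    P (G x) + P (G (-x)) = P (G y) + P (G (-y)) := by
  have hd : ∀ z, HasDerivAt (fun z ↦ P (G z) + P (G (-z))) 0 z := by
    intro z
    have h₁ := (hP (G z)).comp z (hG z)
    have h₂ := (hP (G (-z))).comp z (hasDerivAt_comp_neg_of_reflected hG z)
    exact (h₁.add h₂).congr_deriv (by ring)
  exact is_const_of_deriv_eq_zero (fun z ↦ (hd z).differentiableAt) (fun z ↦ (hd z).deriv) x y

theorem lipschitzOnWith_reflected_field {s : Set ℝ} {K : ℝ≥0} (hW : LipschitzOnWith K W s) :
    LipschitzOnWith K (fun p : ℝ × ℝ ↦ (W p.2, -W p.1)) (s ×ˢ s) := by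
  rw [lipschitzOnWith_iff_dist_le_mul] at hW ⊢
  rintro p ⟨hp₁, hp₂⟩ q ⟨hq₁, hq₂⟩
  rw [Prod.dist_eq, dist_neg_neg]
  refine max_le ((hW _ hp₂ _ hq₂).trans ?_) ((hW _ hp₁ _ hq₁).trans ?_) <;> gcongr
  · exact le_max_right _ _
  · exact le_max_left _ _

/-- Solutions of `G' x = W (G (-x))` with values in a set on which `W` is Lipschitz are determined
by their value at `0`. -/
theorem reflected_unique {s : Set ℝ} {K : ℝ≥0} (hW : LipschitzOnWith K W s) {G₁ G₂ : ℝ → ℝ}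
    (h₁ : ∀ x, HasDerivAt G₁ (W (G₁ (-x))) x) (h₁s : ∀ x, G₁ x ∈ s)
    (h₂ : ∀ x, HasDerivAt G₂ (W (G₂ (-x))) x) (h₂s : ∀ x, G₂ x ∈ s) (h₀ : G₁ 0 = G₂ 0) :
    G₁ = G₂ := by
  have h := ODE_solution_unique_univ (v := fun _ (p : ℝ × ℝ) ↦ (W p.2, -W p.1))
    (s := fun _ ↦ s ×ˢ s) (t₀ := 0) (f := fun x ↦ (G₁ x, G₁ (-x))) (g := fun x ↦ (G₂ x, G₂ (-x)))
    (fun _ ↦ lipschitzOnWith_reflected_field hW)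
    (fun x ↦ ⟨(h₁ x).prodMk (hasDerivAt_comp_neg_of_reflected h₁ x), h₁s _, h₁s _⟩)
    (fun x ↦ ⟨(h₂ x).prodMk (hasDerivAt_comp_neg_of_reflected h₂ x), h₂s _, h₂s _⟩)
    (by simp [h₀])
  exact funext fun x ↦ congrArg Prod.fst (congrFun h x)

/-- The reflected equation `G' x = W (G (-x))` with bounded Lipschitz `W` has a solution with any
prescribed value at `0`. -/
theorem reflected_exists {K L : ℝ≥0} (hW : LipschitzWith K W) (hL : ∀ g, |W g| ≤ L) (g₀ : ℝ) :
    ∃ G : ℝ → ℝ, G 0 = g₀ ∧ ∀ x, HasDerivAt G (W (G (-x))) x := by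
  have hv : LipschitzWith K (fun p : ℝ × ℝ ↦ (W p.2, -W p.1)) := by
    simpa using lipschitzOnWith_reflected_field (hW.lipschitzOnWith (s := univ))
  obtain ⟨γ, hγ₀, hγ⟩ := exists_global_integralCurve hv (L := L)
    (fun p ↦ by simpa [Prod.norm_def] using ⟨hL p.2, hL p.1⟩) (g₀, g₀)
  have hfst : ∀ t, HasDerivAt (fun t ↦ (γ t).1) (W (γ t).2) t := fun t ↦ by
    simpa using (hγ t).hasFDerivAt.fst.hasDerivAt
  have hsnd : ∀ t, HasDerivAt (fun t ↦ (γ t).2) (-W (γ t).1) t := fun t ↦ by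
    simpa using (hγ t).hasFDerivAt.snd.hasDerivAt
  have hswap : γ = fun t ↦ ((γ (-t)).2, (γ (-t)).1) := by
    refine ODE_solution_unique_univ (v := fun _ (p : ℝ × ℝ) ↦ (W p.2, -W p.1)) (K := K)
      (s := fun _ ↦ univ) (t₀ := 0) (fun _ ↦ hv.lipschitzOnWith)
      (fun t ↦ ⟨hγ t, mem_univ _⟩) (fun t ↦ ⟨?_, mem_univ _⟩) (by simp [hγ₀])
    refine HasDerivAt.prodMk ?_ ?_
    · exact ((hsnd (-t)).scomp t (hasDerivAt_neg t)).congr_deriv (by simp)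
    · exact ((hfst (-t)).scomp t (hasDerivAt_neg t)).congr_deriv (by simp)
  refine ⟨fun t ↦ (γ t).1, by simp [hγ₀], fun t ↦ ?_⟩
  have h : (γ t).2 = (γ (-t)).1 := congrArg Prod.snd (congrFun hswap t)
  simpa [h] using hfst t

end Reflected

/-- The integrand `(1 + g) e^{-g}` of the order-parameter equation. -/
noncomputable def cavityWeight (g : ℝ) : ℝ := (1 + g) * Real.exp (-g)

/-- The primitive `(2 + g) e^{-g}` of `-cavityWeight`. -/
noncomputable def cavityPotential (g : ℝ) : ℝ := (2 + g) * Real.exp (-g)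

theorem hasDerivAt_cavityWeight (g : ℝ) :
    HasDerivAt cavityWeight (-(g * Real.exp (-g))) g := by
  have h := ((hasDerivAt_id g).const_add 1).mul (hasDerivAt_neg g).exp
  exact h.congr_deriv (by simp; ring)

theorem hasDerivAt_cavityPotential (g : ℝ) :
    HasDerivAt cavityPotential (-cavityWeight g) g := by
  have h := ((hasDerivAt_id g).const_add 2).mul (hasDerivAt_neg g).exp
  exact h.congr_deriv (by simp [cavityWeight]; ring)

theorem continuous_cavityWeight : Continuous cavityWeight := by
  unfold cavityWeight; fun_prop

theorem continuous_cavityPotential : Continuous cavityPotential := by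
  unfold cavityPotential; fun_prop

theorem cavityWeight_pos {g : ℝ} (hg : -1 < g) : 0 < cavityWeight g :=
  mul_pos (by linarith) (exp_pos _)

theorem cavityPotential_pos {g : ℝ} (hg : -2 < g) : 0 < cavityPotential g :=
  mul_pos (by linarith) (exp_pos _)

theorem cavityPotential_zero : cavityPotential 0 = 2 := by simp [cavityPotential]

theorem cavityWeight_le_one (g : ℝ) : cavityWeight g ≤ 1 := by
  rw [cavityWeight, exp_neg, ← div_eq_mul_inv, div_le_one (exp_pos g), add_comm]
  exact add_one_le_exp g

theorem strictAntiOn_cavityPotential : StrictAntiOn cavityPotential (Ici 0) := by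
  refine strictAntiOn_of_deriv_neg (convex_Ici 0) continuous_cavityPotential.continuousOn ?_
  intro g hg
  rw [interior_Ici, mem_Ioi] at hg
  rw [(hasDerivAt_cavityPotential g).deriv]
  linarith [cavityWeight_pos (g := g) (by linarith)]

theorem tendsto_cavityPotential_atTop : Tendsto cavityPotential atTop (𝓝 0) := by
  have h := ((tendsto_pow_mul_exp_neg_atTop_nhds_zero 0).const_mul 2).add
    (tendsto_pow_mul_exp_neg_atTop_nhds_zero 1)
  simp only [mul_zero, add_zero] at h
  exact h.congr fun g ↦ by rw [cavityPotential]; ring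

theorem lipschitzOnWith_cavityWeight : LipschitzOnWith 1 cavityWeight (Ici 0) := by
  refine (convex_Ici 0).lipschitzOnWith_of_nnnorm_hasDerivWithin_le
    (fun g _ ↦ (hasDerivAt_cavityWeight g).hasDerivWithinAt) fun g hg ↦ ?_
  rw [mem_Ici] at hg
  rw [← NNReal.coe_le_coe, coe_nnnorm, norm_neg, Real.norm_eq_abs,
    abs_of_nonneg (mul_nonneg hg (exp_pos _).le)]
  have := cavityWeight_le_one g
  rw [cavityWeight] at this
  simp only [NNReal.coe_one]
  nlinarith [exp_pos (-g)]

theorem exists_cavityPotential_eq_one : ∃ g, 0 ≤ g ∧ cavityPotential g = 1 := by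
  obtain ⟨N, hN⟩ := ((tendsto_cavityPotential_atTop.eventually_lt_const one_pos).and
    (eventually_ge_atTop 0)).exists
  obtain ⟨g, hg, h⟩ := intermediate_value_Icc' hN.2 continuous_cavityPotential.continuousOn
    ⟨hN.1.le, by rw [cavityPotential_zero]; norm_num⟩
  exact ⟨g, hg.1, h⟩

/-- The order-parameter equation implies the reflected differential equation and decay at `-∞`. -/
theorem reflected_of_order_parameter_equation {G : ℝ → ℝ} (hc : Continuous G)
    (hG : ∀ x : ℝ, IntegrableOn (fun y ↦ cavityWeight (G y)) (Ioi (-x)) ∧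
      G x = ∫ y in Ioi (-x), cavityWeight (G y)) :
    (∀ x, HasDerivAt G (cavityWeight (G (-x))) x) ∧ Tendsto (fun x ↦ G (-x)) atTop (𝓝 0) := by
  have hcont : Continuous fun y ↦ cavityWeight (G y) := continuous_cavityWeight.comp hc
  refine ⟨fun x ↦ ?_, ?_⟩
  · have hsplit : G = fun x ↦ G 0 - ∫ y in (0 : ℝ)..(-x), cavityWeight (G y) := by
      funext x
      have h₀ := (hG 0).1
      have hE₀ := (hG 0).2
      rw [neg_zero] at h₀ hE₀
      rw [(hG x).2, hE₀, ← intervalIntegral.integral_interval_add_Ioi h₀ (hG x).1]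
      ring
    have hFTC : HasDerivAt (fun u ↦ ∫ y in (0 : ℝ)..u, cavityWeight (G y))
        (cavityWeight (G (-x))) (-x) :=
      intervalIntegral.integral_hasDerivAt_right (hcont.intervalIntegrable _ _)
        hcont.aestronglyMeasurable.stronglyMeasurableAtFilter hcont.continuousAt
    have h := (hFTC.scomp x (hasDerivAt_neg x)).const_sub (G 0)
    rw [neg_smul, one_smul, neg_neg] at h
    exact h.congr_of_eventuallyEq (Eventually.of_forall (congrFun hsplit))
  · refine (tendsto_integral_Ioi_zero (f := fun y ↦ cavityWeight (G y)) (μ := volume)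
      tendsto_id).congr fun x ↦ ?_
    rw [(hG (-x)).2, neg_neg, id]

/-- Every solution of the order-parameter equation is nonnegative and takes at `0` a value of
potential `1`. -/
theorem order_parameter_equation_nonneg {G : ℝ → ℝ} (hc : Continuous G)
    (hG : ∀ x : ℝ, IntegrableOn (fun y ↦ cavityWeight (G y)) (Ioi (-x)) ∧
      G x = ∫ y in Ioi (-x), cavityWeight (G y)) :
    (∀ x, 0 ≤ G x) ∧ cavityPotential (G 0) = 1 := by
  obtain ⟨hder, hlim⟩ := reflected_of_order_parameter_equation hc hG
  have hW : Tendsto (fun x ↦ cavityWeight (G (-x))) atTop (𝓝 1) := by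
    have h := (continuous_cavityWeight.tendsto 0).comp hlim
    rwa [show cavityWeight 0 = 1 by simp [cavityWeight]] at h
  have htop : Tendsto G atTop atTop :=
    tendsto_atTop_of_le_hasDerivAt hder (c := 1 / 2) (by norm_num)
      (hW.eventually_const_le (by norm_num))
  have hconst : ∀ x, cavityPotential (G x) + cavityPotential (G (-x)) = 2 := by
    intro x
    have h := (tendsto_cavityPotential_atTop.comp htop).add
      ((continuous_cavityPotential.tendsto 0).comp hlim)
    rw [cavityPotential_zero, zero_add] at h
    exact tendsto_nhds_unique (tendsto_const_nhds.congr fun y ↦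
      reflected_first_integral hasDerivAt_cavityPotential hder x y) h
  have hne : ∀ x, -1 ≤ G (-x) → G x ≠ -1 := by
    intro x hx h
    have h₁ := hconst x
    have h₂ := cavityPotential_pos (g := G (-x)) (by linarith)
    have h₃ : cavityPotential (-1) = Real.exp 1 := by norm_num [cavityPotential]
    rw [h, h₃] at h₁
    linarith [exp_one_gt_two]
  have huniv : {x | -1 ≤ G x ∧ -1 ≤ G (-x)} = univ := by
    refine IsClopen.eq_univ ⟨?_, ?_⟩ ?_
    · exact (isClosed_le continuous_const hc).inter
        (isClosed_le continuous_const (hc.comp continuous_neg))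
    · have : {x | -1 ≤ G x ∧ -1 ≤ G (-x)} = {x | -1 < G x ∧ -1 < G (-x)} := by
        ext x
        refine ⟨fun h ↦ ⟨h.1.lt_of_ne' (hne x h.2), h.2.lt_of_ne' (hne (-x) ?_)⟩,
          fun h ↦ ⟨h.1.le, h.2.le⟩⟩
        rw [neg_neg]
        exact h.1
      rw [this]
      exact (isOpen_lt continuous_const hc).inter
        (isOpen_lt continuous_const (hc.comp continuous_neg))
    · exact ((htop.eventually_ge_atTop (-1)).and
        (hlim.eventually_const_le (by norm_num))).exists
  have hge : ∀ x, -1 ≤ G x := fun x ↦ (huniv ▸ mem_univ x : x ∈ {x | -1 ≤ G x ∧ -1 ≤ G (-x)}).1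
  refine ⟨fun x ↦ ?_, ?_⟩
  · rw [(hG x).2]
    exact integral_nonneg fun y ↦ mul_nonneg (by linarith [hge y]) (exp_pos _).le
  · have := hconst 0
    rw [neg_zero] at this
    linarith

/-- A nonnegative solution of the reflected equation starting at potential `1` solves the
order-parameter equation. -/
theorem order_parameter_equation_of_reflected {G : ℝ → ℝ} (hpos : ∀ x, 0 ≤ G x)
    (h₀ : cavityPotential (G 0) = 1) (hder : ∀ x, HasDerivAt G (cavityWeight (G (-x))) x) (x : ℝ) :
    IntegrableOn (fun y ↦ cavityWeight (G y)) (Ioi (-x)) ∧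
      G x = ∫ y in Ioi (-x), cavityWeight (G y) := by
  have hWnn : ∀ y, 0 ≤ cavityWeight (G y) := fun y ↦
    (cavityWeight_pos (by linarith [hpos y])).le
  have hmono : Monotone G := monotone_of_hasDerivAt_nonneg hder fun y ↦ hWnn (-y)
  have htop : Tendsto G atTop atTop := by
    refine tendsto_atTop_of_le_hasDerivAt hder (exp_pos (-G 0)) ?_
    filter_upwards [eventually_ge_atTop 0] with y hy
    have hle : G (-y) ≤ G 0 := hmono (by linarith)
    calc Real.exp (-G 0) ≤ Real.exp (-G (-y)) := exp_le_exp.mpr (by linarith)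
      _ ≤ cavityWeight (G (-y)) :=
        le_mul_of_one_le_left (exp_pos _).le (by linarith [hpos (-y)])
  have hpot : Tendsto (fun y ↦ cavityPotential (G (-y))) atTop (𝓝 2) := by
    have h := (tendsto_cavityPotential_atTop.comp htop).const_sub 2
    rw [sub_zero] at h
    refine h.congr fun y ↦ ?_
    have := reflected_first_integral hasDerivAt_cavityPotential hder y 0
    rw [neg_zero, h₀] at this
    simp only [Function.comp]
    linarith
  have hlim : Tendsto (fun y ↦ G (-y)) atTop (𝓝 0) := by
    refine tendsto_order.mpr ⟨fun a ha ↦ .of_forall fun y ↦ ha.trans_le (hpos _), fun ε hε ↦ ?_⟩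
    have hlt : cavityPotential ε < 2 := by
      rw [← cavityPotential_zero]
      exact strictAntiOn_cavityPotential self_mem_Ici (mem_Ici.mpr hε.le) hε
    filter_upwards [hpot.eventually_const_lt hlt] with y hy
    exact (strictAntiOn_cavityPotential.lt_iff_gt (mem_Ici.mpr hε.le) (mem_Ici.mpr (hpos _))).mp hy
  have hprim : ∀ y ∈ Ici (-x), HasDerivAt (fun y ↦ -G (-y)) (cavityWeight (G y)) y := fun y _ ↦ by
    exact (hasDerivAt_comp_neg_of_reflected hder y).neg.congr_deriv (neg_neg _)
  have hlim' : Tendsto (fun y ↦ -G (-y)) atTop (𝓝 0) := by simpa using hlim.neg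
  refine ⟨integrableOn_Ioi_deriv_of_nonneg' hprim (fun y _ ↦ hWnn y) hlim', ?_⟩
  rw [integral_Ioi_of_hasDerivAt_of_nonneg' hprim (fun y _ ↦ hWnn y) hlim']
  simp

/-- There is a nonnegative solution of the reflected equation starting at potential `1`. -/
theorem exists_reflected_cavity_solution : ∃ G : ℝ → ℝ, (∀ x, 0 ≤ G x) ∧
    cavityPotential (G 0) = 1 ∧ ∀ x, HasDerivAt G (cavityWeight (G (-x))) x := by
  obtain ⟨g₀, hg₀, hP₀⟩ := exists_cavityPotential_eq_one
  set W : ℝ → ℝ := fun g ↦ cavityWeight (max g 0) with hW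
  have hWnn : ∀ g, 0 ≤ W g := fun g ↦
    (cavityWeight_pos (by linarith [le_max_right g 0])).le
  have hWeq : ∀ g, 0 ≤ g → W g = cavityWeight g := fun g hg ↦ by simp [hW, hg]
  have hLip : LipschitzWith 1 W := by
    have := lipschitzOnWith_cavityWeight.comp
      ((LipschitzWith.id.max_const 0).lipschitzOnWith (s := univ))
      (fun g _ ↦ le_max_right g (0 : ℝ))
    simpa [hW, Function.comp_def] using this
  obtain ⟨G, hG₀, hG⟩ := reflected_exists hLip (L := 1)
    (fun g ↦ by rw [abs_of_nonneg (hWnn g)]; exact cavityWeight_le_one _) g₀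
  set P : ℝ → ℝ := fun g ↦ 2 - ∫ y in (0 : ℝ)..g, W y
  have hP : ∀ g, HasDerivAt P (-W g) g := fun g ↦
    (intervalIntegral.integral_hasDerivAt_right (hLip.continuous.intervalIntegrable _ _)
      hLip.continuous.aestronglyMeasurable.stronglyMeasurableAtFilter
      hLip.continuous.continuousAt).const_sub 2
  have hPeq : ∀ g, 0 ≤ g → P g = cavityPotential g := by
    intro g hg
    have h : ∫ y in (0 : ℝ)..g, W y = -cavityPotential g - -cavityPotential 0 := by
      refine intervalIntegral.integral_eq_sub_of_hasDerivAt (f := fun y ↦ -cavityPotential y)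
        (fun y hy ↦ ?_) (hLip.continuous.intervalIntegrable _ _)
      rw [uIcc_of_le hg] at hy
      exact (hasDerivAt_cavityPotential y).neg.congr_deriv (by rw [neg_neg, hWeq y hy.1])
    simp only [P, h, cavityPotential_zero]
    ring
  have hPanti : Antitone P := antitone_of_hasDerivAt_nonpos hP fun g ↦ neg_nonpos.mpr (hWnn g)
  have hP_zero : P 0 = 2 := by rw [hPeq 0 le_rfl, cavityPotential_zero]
  have hPpos : ∀ g, 0 < P g := fun g ↦ by
    rcases le_total 0 g with hg | hg
    · rw [hPeq g hg]
      exact cavityPotential_pos (by linarith)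
    · linarith [hPanti hg]
  have hGnn : ∀ x, 0 ≤ G x := by
    intro x
    have h := reflected_first_integral hP hG x 0
    rw [neg_zero, hG₀, hPeq g₀ hg₀, hP₀] at h
    by_contra! hx
    linarith [hPanti hx.le, hPpos (G (-x))]
  exact ⟨G, hGnn, hG₀ ▸ hP₀, fun x ↦ hWeq _ (hGnn (-x)) ▸ hG x⟩

/-- The TSP order-parameter (Krauth–Mézard–Parisi) equation
`G(x) = ∫_{-x}^∞ (1 + G(y)) e^{-G(y)} dy` has exactly one continuous solution. -/
theorem tsp_order_parameter_equation_unique_solution :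
    ∃! G : ℝ → ℝ, Continuous G ∧
      ∀ x : ℝ,
        IntegrableOn (fun y => (1 + G y) * Real.exp (-G y)) (Ioi (-x)) ∧
        G x = ∫ y in Ioi (-x), (1 + G y) * Real.exp (-G y) := by
  obtain ⟨G, hpos, h₀, hder⟩ := exists_reflected_cavity_solution
  refine ⟨G, ⟨continuous_iff_continuousAt.mpr fun x ↦ (hder x).continuousAt,
    order_parameter_equation_of_reflected hpos h₀ hder⟩, ?_⟩
  rintro H ⟨hc, hH⟩
  obtain ⟨hHpos, hH₀⟩ := order_parameter_equation_nonneg hc hH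
  exact reflected_unique lipschitzOnWith_cavityWeight
    (reflected_of_order_parameter_equation hc hH).1 hHpos hder hpos
    (strictAntiOn_cavityPotential.injOn (hHpos 0) (hpos 0) (hH₀.trans h₀.symm))
end

section
/- Let Λ : (0, ∞) → (0, ∞) be the function mapping x > 0 to the unique y > 0 satisfying (1 + x/2)·e^{−x} + (1 + y/2)·e^{−y} = 1. If G : ℝ → ℝ is continuous and satisfies, for every x ∈ ℝ, that y ↦ (1 + G(y))·exp(−G(y)) is integrable on (−x, ∞) and G(x) = ∫_{−x}^∞ (1 + G(y))·exp(−G(y)) dy, then ∫_{−∞}^∞ G(x)·(1 + G(x))·exp(−G(x)) dx = ∫_0^∞ Λ(t) dt. -/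
open Real MeasureTheory Set Filter Topology

/-- The derivative of `g ↦ (1 + g / 2) e^{-g}`. -/
lemma hasDerivAt_one_add_half_mul_exp_neg (g : ℝ) :
    HasDerivAt (fun g : ℝ => (1 + g / 2) * Real.exp (-g))
      (-((1 + g) * Real.exp (-g)) / 2) g := by
  have h₁ : HasDerivAt (fun g : ℝ => 1 + g / 2) (1 / 2) g :=
    ((hasDerivAt_id g).div_const 2).const_add 1
  have h₂ : HasDerivAt (fun g : ℝ => Real.exp (-g)) (Real.exp (-g) * -1) g :=
    (hasDerivAt_neg g).exp
  refine (h₁.mul h₂).congr_deriv ?_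
  ring

lemma strictAntiOn_one_add_half_mul_exp_neg :
    StrictAntiOn (fun g : ℝ => (1 + g / 2) * Real.exp (-g)) (Ici 0) := by
  refine strictAntiOn_of_deriv_neg (convex_Ici 0) (by fun_prop) fun g hg => ?_
  rw [interior_Ici, mem_Ioi] at hg
  rw [(hasDerivAt_one_add_half_mul_exp_neg g).deriv]
  have : 0 < (1 + g) * Real.exp (-g) := by positivity
  linarith

lemma tendsto_one_add_half_mul_exp_neg :
    Tendsto (fun g : ℝ => (1 + g / 2) * Real.exp (-g)) atTop (𝓝 0) := by
  have h₀ := Real.tendsto_pow_mul_exp_neg_atTop_nhds_zero 0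
  have h₁ := Real.tendsto_pow_mul_exp_neg_atTop_nhds_zero 1
  have h := h₀.add (h₁.div_const 2)
  simp only [zero_div, add_zero] at h
  refine h.congr fun g => ?_
  ring

lemma one_le_one_add_half_mul_exp_neg {g : ℝ} (h₁ : -1 ≤ g) (h₂ : g ≤ 0) :
    1 ≤ (1 + g / 2) * Real.exp (-g) := by
  have h := Real.add_one_le_exp (-g)
  have : (1 + g / 2) * (-g + 1) ≤ (1 + g / 2) * Real.exp (-g) :=
    mul_le_mul_of_nonneg_left h (by linarith)
  nlinarith [mul_nonneg (neg_nonneg.2 h₂) (by linarith : 0 ≤ 1 + g)]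

section OrderParameter

variable {G : ℝ → ℝ}

/-- A continuous solution of the order-parameter equation satisfies
`G'(x) = (1 + G(-x)) e^{-G(-x)}` and tends to `0` at `-∞`. -/
lemma orderParameter_hasDerivAt_and_tendsto (hG : Continuous G)
    (hGeq : ∀ x : ℝ,
      IntegrableOn (fun y => (1 + G y) * Real.exp (-G y)) (Ioi (-x)) ∧
      G x = ∫ y in Ioi (-x), (1 + G y) * Real.exp (-G y)) :
    (∀ x, HasDerivAt G ((1 + G (-x)) * Real.exp (-G (-x))) x) ∧
      Tendsto (fun x => G (-x)) atTop (𝓝 0) := by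
  set F : ℝ → ℝ := fun y => (1 + G y) * Real.exp (-G y) with hF
  have hFc : Continuous F := by fun_prop
  have hint : IntegrableOn F (Ioi 0) := by simpa using (hGeq 0).1
  have h0 : G 0 = ∫ y in Ioi (0 : ℝ), F y := by simpa using (hGeq 0).2
  have key : ∀ x, G (-x) = G 0 - ∫ y in (0 : ℝ)..x, F y := fun x => by
    have hx : IntegrableOn F (Ioi x) := by simpa using (hGeq (-x)).1
    have hGx : G (-x) = ∫ y in Ioi x, F y := by simpa using (hGeq (-x)).2
    have := intervalIntegral.integral_Ioi_sub_Ioi' hint hx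
    linarith
  refine ⟨fun x => ?_, ?_⟩
  · have h₁ : HasDerivAt (fun x => ∫ y in (0 : ℝ)..x, F y) (F (-x)) (-x) :=
      intervalIntegral.integral_hasDerivAt_right (hFc.intervalIntegrable _ _)
        (hFc.stronglyMeasurableAtFilter _ _) hFc.continuousAt
    have h₂ := (h₁.comp x (hasDerivAt_neg x)).const_sub (G 0)
    have h₃ : G = fun x => G 0 - ((fun x => ∫ y in (0 : ℝ)..x, F y) ∘ Neg.neg) x := by
      funext x
      simpa using key (-x)
    rw [← h₃] at h₂
    exact h₂.congr_deriv (by simp [hF])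
  · have h := (intervalIntegral_tendsto_integral_Ioi 0 hint tendsto_id).const_sub (G 0)
    rw [← h0, sub_self] at h
    exact h.congr fun x => (key x).symm

lemma orderParameter_tendsto_atTop
    (hd : ∀ x, HasDerivAt G ((1 + G (-x)) * Real.exp (-G (-x))) x)
    (hbot : Tendsto (fun x => G (-x)) atTop (𝓝 0)) : Tendsto G atTop atTop := by
  have hlim : Tendsto (fun x => (1 + G (-x)) * Real.exp (-G (-x))) atTop (𝓝 1) := by
    have hc : Continuous fun g : ℝ => (1 + g) * Real.exp (-g) := by fun_prop
    simpa [Function.comp_def] using (hc.tendsto 0).comp hbot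
  obtain ⟨A, hA⟩ := eventually_atTop.1
    (hlim.eventually (lt_mem_nhds (by norm_num : (1 / 2 : ℝ) < 1)))
  have hlow : ∀ x ≥ A, 1 / 2 * (x - A) + G A ≤ G x := fun x hx => by
    have := Convex.mul_sub_le_image_sub_of_le_deriv (convex_Ici A)
      (f := G) (fun y _ => (hd y).continuousAt.continuousWithinAt)
      (fun y _ => (hd y).differentiableAt.differentiableWithinAt) (C := 1 / 2)
      (fun y hy => by
        rw [interior_Ici, mem_Ioi] at hy
        rw [(hd y).deriv]
        exact (hA y hy.le).le) A self_mem_Ici x hx hx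
    linarith
  refine tendsto_atTop_mono' atTop ((eventually_ge_atTop A).mono hlow) ?_
  refine tendsto_atTop_add_const_right _ _ (Tendsto.const_mul_atTop (by norm_num) ?_)
  exact tendsto_atTop_add_const_right _ _ tendsto_id

/-- The conserved quantity of the order-parameter equation. -/
lemma orderParameter_conservation
    (hd : ∀ x, HasDerivAt G ((1 + G (-x)) * Real.exp (-G (-x))) x)
    (hbot : Tendsto (fun x => G (-x)) atTop (𝓝 0)) (x : ℝ) :
    (1 + G x / 2) * Real.exp (-G x) + (1 + G (-x) / 2) * Real.exp (-G (-x)) = 1 := by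
  set K : ℝ → ℝ := fun g => (1 + g / 2) * Real.exp (-g) with hK
  have hder : ∀ x, HasDerivAt (fun x => K (G x) + K (G (-x))) 0 x := fun x => by
    have h₁ := (hasDerivAt_one_add_half_mul_exp_neg (G x)).comp x (hd x)
    have h₂ := (hasDerivAt_one_add_half_mul_exp_neg (G (-x))).comp x
      ((hd (-x)).comp x (hasDerivAt_neg x))
    refine (h₁.add h₂).congr_deriv ?_
    rw [neg_neg]
    ring
  have hconst : ∀ y, K (G y) + K (G (-y)) = K (G x) + K (G (-x)) := fun y =>
    is_const_of_deriv_eq_zero (fun z => (hder z).differentiableAt)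
      (fun z => (hder z).deriv) y x
  have hKc : Continuous K := by fun_prop
  have h₁ : Tendsto (fun y => K (G y)) atTop (𝓝 0) :=
    tendsto_one_add_half_mul_exp_neg.comp (orderParameter_tendsto_atTop hd hbot)
  have h₂ : Tendsto (fun y => K (G (-y))) atTop (𝓝 1) := by
    simpa [hK, Function.comp_def] using (hKc.tendsto 0).comp hbot
  have h₃ := h₁.add h₂
  simp only [hconst, zero_add] at h₃
  exact tendsto_nhds_unique tendsto_const_nhds h₃

lemma orderParameter_pos
    (hd : ∀ x, HasDerivAt G ((1 + G (-x)) * Real.exp (-G (-x))) x)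
    (hbot : Tendsto (fun x => G (-x)) atTop (𝓝 0)) (x : ℝ) : 0 < G x := by
  have hG : Continuous G := continuous_iff_continuousAt.2 fun x => (hd x).continuousAt
  have hcons := orderParameter_conservation hd hbot
  have hne : ∀ x, 0 ≤ G (-x) → G x ≠ 0 := fun x hx h0 => by
    have h := hcons x
    have : 0 < (1 + G (-x) / 2) * Real.exp (-G (-x)) := by positivity
    rw [h0, neg_zero, Real.exp_zero] at h
    linarith
  have hS : {x | 0 < G x ∧ 0 < G (-x)} = {x | 0 ≤ G x ∧ 0 ≤ G (-x)} := by
    ext x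
    refine ⟨fun h => ⟨h.1.le, h.2.le⟩, fun h => ⟨h.1.lt_of_ne' (hne x h.2),
      h.2.lt_of_ne' (hne (-x) (by simpa using h.1))⟩⟩
  have hopen : IsOpen {x | 0 < G x ∧ 0 < G (-x)} :=
    (isOpen_lt continuous_const hG).inter
      (isOpen_lt continuous_const (hG.comp continuous_neg))
  have hclosed : IsClosed {x | 0 < G x ∧ 0 < G (-x)} := by
    rw [hS]
    exact (isClosed_le continuous_const hG).inter
      (isClosed_le continuous_const (hG.comp continuous_neg))
  have hnonempty : {x | 0 < G x ∧ 0 < G (-x)}.Nonempty := by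
    obtain ⟨y, hy₁, hy₂⟩ := (((orderParameter_tendsto_atTop hd hbot).eventually_gt_atTop 0).and
      (hbot.eventually (lt_mem_nhds (by norm_num : (-1 : ℝ) < 0)))).exists
    refine ⟨y, hy₁, ?_⟩
    by_contra! hle
    have h := hcons y
    have h₁ := one_le_one_add_half_mul_exp_neg hy₂.le hle
    have : 0 < (1 + G y / 2) * Real.exp (-G y) := by positivity
    linarith
  have huniv := IsClopen.eq_univ ⟨hclosed, hopen⟩ hnonempty
  exact (huniv.symm ▸ mem_univ x : x ∈ {x | 0 < G x ∧ 0 < G (-x)}).1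

end OrderParameter

/-- The cavity characterization of the TSP ground state limit agrees with the
rigorously derived one: if `Λ` maps `x > 0` to the unique `y > 0` with
`(1 + x/2) e^{-x} + (1 + y/2) e^{-y} = 1`, and `G` is a continuous solution of the
TSP order-parameter equation, then
`∫ G(x)(1 + G(x)) e^{-G(x)} dx = ∫_0^∞ Λ(t) dt`. -/
theorem tsp_ground_state_agreement
    (Λ : ℝ → ℝ)
    (hΛ : ∀ x : ℝ, 0 < x → 0 < Λ x ∧
      (1 + x / 2) * Real.exp (-x) + (1 + Λ x / 2) * Real.exp (-(Λ x)) = 1)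
    (G : ℝ → ℝ) (hG : Continuous G)
    (hGeq : ∀ x : ℝ,
      IntegrableOn (fun y => (1 + G y) * Real.exp (-G y)) (Ioi (-x)) ∧
      G x = ∫ y in Ioi (-x), (1 + G y) * Real.exp (-G y)) :
    (∫ x : ℝ, G x * (1 + G x) * Real.exp (-G x)) = ∫ t in Ioi (0 : ℝ), Λ t := by
  obtain ⟨hd, hbot⟩ := orderParameter_hasDerivAt_and_tendsto hG hGeq
  have hpos := orderParameter_pos hd hbot
  have hdpos : ∀ x, 0 < (1 + G (-x)) * Real.exp (-G (-x)) := fun x => by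
    have := hpos (-x)
    positivity
  have hmono : StrictMono G := strictMono_of_deriv_pos fun x => by
    rw [(hd x).deriv]
    exact hdpos x
  have hrange : G '' univ = Ioi 0 := by
    rw [image_univ]
    refine Subset.antisymm (range_subset_iff.2 hpos) fun t ht => ?_
    obtain ⟨a, ha⟩ := (hbot.eventually (gt_mem_nhds (mem_Ioi.1 ht))).exists
    obtain ⟨b, hb⟩ :=
      ((orderParameter_tendsto_atTop hd hbot).eventually_ge_atTop t).exists
    exact mem_range_of_exists_le_of_exists_ge hG ⟨-a, ha.le⟩ ⟨b, hb⟩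
  have hΛG : ∀ x, Λ (G x) = G (-x) := fun x => by
    obtain ⟨h₁, h₂⟩ := hΛ (G x) (hpos x)
    have h₃ := orderParameter_conservation hd hbot x
    refine strictAntiOn_one_add_half_mul_exp_neg.injOn h₁.le (hpos (-x)).le ?_
    linarith
  rw [← hrange, integral_image_eq_integral_abs_deriv_smul MeasurableSet.univ
    (fun x _ => (hd x).hasDerivWithinAt) hmono.injective.injOn, setIntegral_univ,
    ← integral_neg_eq_self]
  refine integral_congr_ae (ae_of_all _ fun x => ?_)
  simp only [hΛG, abs_of_pos (hdpos x), smul_eq_mul]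
  ring
end

section
/- If G : ℝ → ℝ is continuous and satisfies, for every x ∈ ℝ, that y ↦ (1 + G(y))·exp(−G(y)) is integrable on (−x, ∞) and G(x) = ∫_{−x}^∞ (1 + G(y))·exp(−G(y)) dy, then for every x ∈ ℝ one has (2 + G(x))·exp(−G(x)) + (2 + G(−x))·exp(−G(−x)) = 2. -/
open Real MeasureTheory Set

open Filter Topology

/-- A function whose derivative tends to a positive limit at `+∞` tends to `+∞`. -/
lemma tendsto_atTop_of_hasDerivAt_tendsto_pos {g g' : ℝ → ℝ} {c : ℝ} (hc : 0 < c)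
    (hg : ∀ x, HasDerivAt g (g' x) x) (hlim : Tendsto g' atTop (𝓝 c)) :
    Tendsto g atTop atTop := by
  obtain ⟨N, hN⟩ := eventually_atTop.1 (hlim.eventually (lt_mem_nhds (half_lt_self hc)))
  have hbound : ∀ x, N ≤ x → g N + c / 2 * (x - N) ≤ g x := by
    intro x hx
    have := (convex_Ici N).mul_sub_le_image_sub_of_le_deriv
      (fun y _ => (hg y).continuousAt.continuousWithinAt)
      (fun y _ => (hg y).differentiableAt.differentiableWithinAt)
      (C := c / 2) (fun y hy => by
        rw [(hg y).deriv]
        exact (hN y (interior_subset hy)).le)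
      N self_mem_Ici x hx hx
    linarith
  refine tendsto_atTop_mono' atTop ((eventually_ge_atTop N).mono hbound) ?_
  refine tendsto_atTop_add_const_left _ _ (Tendsto.const_mul_atTop (half_pos hc) ?_)
  exact tendsto_atTop_add_const_right _ _ tendsto_id

lemma tendsto_two_add_mul_exp_neg_atTop :
    Tendsto (fun g : ℝ => (2 + g) * Real.exp (-g)) atTop (𝓝 0) := by
  have h1 := Real.tendsto_pow_mul_exp_neg_atTop_nhds_zero 1
  have h0 := Real.tendsto_pow_mul_exp_neg_atTop_nhds_zero 0
  have := (h0.const_mul 2).add h1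
  simp only [mul_zero, add_zero] at this
  refine this.congr fun g => ?_
  ring

/-- Conserved quantity for the TSP order-parameter equation: any continuous
solution satisfies `(2 + G(x)) e^{-G(x)} + (2 + G(-x)) e^{-G(-x)} = 2`. -/
theorem tsp_conserved_quantity
    (G : ℝ → ℝ) (hG : Continuous G)
    (hGeq : ∀ x : ℝ,
      IntegrableOn (fun y => (1 + G y) * Real.exp (-G y)) (Ioi (-x)) ∧
      G x = ∫ y in Ioi (-x), (1 + G y) * Real.exp (-G y)) :
    ∀ x : ℝ,
      (2 + G x) * Real.exp (-G x) + (2 + G (-x)) * Real.exp (-G (-x)) = 2 := by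
  set f : ℝ → ℝ := fun y => (1 + G y) * Real.exp (-G y) with hf
  have hfc : Continuous f := by fun_prop
  have hi0 : IntegrableOn f (Ioi 0) := by simpa using (hGeq 0).1
  have he0 : G 0 = ∫ y in Ioi 0, f y := by simpa using (hGeq 0).2
  have hG0 : ∀ x, G x = G 0 - ∫ y in (0 : ℝ)..(-x), f y := by
    intro x
    rw [← intervalIntegral.integral_Ioi_sub_Ioi' hi0 (hGeq x).1, ← he0, ← (hGeq x).2]
    ring
  have hGderiv : ∀ x, HasDerivAt G (f (-x)) x := by
    intro x
    have h1 : HasDerivAt (fun u => ∫ y in (0 : ℝ)..u, f y) (f (-x)) (-x) :=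
      (hfc.integral_hasStrictDerivAt 0 (-x)).hasDerivAt
    have h2 := (h1.comp x (hasDerivAt_neg x)).const_sub (G 0)
    rw [show G = fun x => G 0 - ∫ y in (0 : ℝ)..(-x), f y from funext hG0]
    simpa [Function.comp_def] using h2
  have hGbot : Tendsto G atBot (𝓝 0) := by
    have h := (intervalIntegral_tendsto_integral_Ioi 0 hi0 tendsto_neg_atBot_atTop).const_sub (G 0)
    rw [← he0, sub_self] at h
    exact h.congr fun x => (hG0 x).symm
  have hfbot : Tendsto f atBot (𝓝 1) := by
    have hc : Continuous fun g : ℝ => (1 + g) * Real.exp (-g) := by fun_prop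
    simpa [Function.comp_def] using (hc.tendsto 0).comp hGbot
  have hGtop : Tendsto G atTop atTop :=
    tendsto_atTop_of_hasDerivAt_tendsto_pos one_pos hGderiv
      (hfbot.comp tendsto_neg_atTop_atBot)
  set H : ℝ → ℝ := fun x => (2 + G x) * Real.exp (-G x) with hH
  have hHderiv : ∀ x, HasDerivAt H (-(f x * f (-x))) x := by
    intro x
    have h := ((hGderiv x).const_add 2).mul (hGderiv x).neg.exp
    refine h.congr_deriv ?_
    simp only [hf, Pi.neg_apply]
    ring
  have hsum : ∀ x, HasDerivAt (fun x => H x + H (-x)) 0 x := by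
    intro x
    have h := (hHderiv x).add ((hHderiv (-x)).comp x (hasDerivAt_neg x))
    refine h.congr_deriv ?_
    rw [neg_neg]
    ring
  have hHtop : Tendsto H atTop (𝓝 0) := tendsto_two_add_mul_exp_neg_atTop.comp hGtop
  have hHbot : Tendsto H atBot (𝓝 2) := by
    have hc : Continuous fun g : ℝ => (2 + g) * Real.exp (-g) := by fun_prop
    simpa [Function.comp_def] using (hc.tendsto 0).comp hGbot
  have hlim : Tendsto (fun x => H x + H (-x)) atTop (𝓝 2) := by
    simpa using hHtop.add (hHbot.comp tendsto_neg_atTop_atBot)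
  intro x
  have hconst : ∀ y, H y + H (-y) = H x + H (-x) := fun y =>
    is_const_of_deriv_eq_zero (fun z => (hsum z).differentiableAt) (fun z => (hsum z).deriv) y x
  exact tendsto_nhds_unique (tendsto_const_nhds.congr fun y => (hconst y).symm) hlim
end

section
/- The function G(x) = log(1 + e^x) solves the matching order-parameter equation: for every x ∈ ℝ, the function y ↦ 1/(1 + e^y) is integrable on (−x, ∞) and ∫_{−x}^∞ dy/(1 + e^y) = log(1 + e^x). -/
open Real MeasureTheory Set

/-- `y ↦ -log (1 + e^{-y})` is an antiderivative of `y ↦ 1 / (1 + e^y)`. -/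
theorem hasDerivAt_neg_log_one_add_exp_neg (y : ℝ) :
    HasDerivAt (fun y => -Real.log (1 + Real.exp (-y))) (1 / (1 + Real.exp y)) y := by
  have hpos : 0 < 1 + Real.exp (-y) := by positivity
  refine (((hasDerivAt_neg y).exp.const_add 1).log hpos.ne').neg.congr_deriv ?_
  rw [Real.exp_neg]
  field_simp
  ring

theorem tendsto_neg_log_one_add_exp_neg_atTop :
    Filter.Tendsto (fun y => -Real.log (1 + Real.exp (-y))) Filter.atTop (nhds 0) := by
  have h := ((Real.tendsto_exp_neg_atTop_nhds_zero.const_add 1).log (by norm_num)).neg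
  simpa using h

/-- `G(x) = log(1 + e^x)` solves the matching order-parameter equation:
for every `x`, the function `y ↦ 1/(1 + e^y)` is integrable on `(-x, ∞)` and
`∫_{-x}^∞ dy/(1 + e^y) = log(1 + e^x)`. -/
theorem matching_order_parameter_explicit_solution :
    ∀ x : ℝ,
      IntegrableOn (fun y => 1 / (1 + Real.exp y)) (Ioi (-x)) ∧
      (∫ y in Ioi (-x), 1 / (1 + Real.exp y)) = Real.log (1 + Real.exp x) := by
  intro x
  have hderiv : ∀ y ∈ Ici (-x), HasDerivAt (fun y => -Real.log (1 + Real.exp (-y)))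
      (1 / (1 + Real.exp y)) y := fun y _ => hasDerivAt_neg_log_one_add_exp_neg y
  have hnonneg : ∀ y ∈ Ioi (-x), 0 ≤ 1 / (1 + Real.exp y) := fun y _ => by positivity
  refine ⟨integrableOn_Ioi_deriv_of_nonneg' hderiv hnonneg
    tendsto_neg_log_one_add_exp_neg_atTop, ?_⟩
  rw [integral_Ioi_of_hasDerivAt_of_nonneg' hderiv hnonneg
    tendsto_neg_log_one_add_exp_neg_atTop]
  simp
end

section
/- If G : ℝ → ℝ is continuous and satisfies, for every x ∈ ℝ, that y ↦ exp(−G(y)) is integrable on (−x, ∞) and G(x) = ∫_{−x}^∞ exp(−G(y)) dy, then G(x) = log(1 + e^x) for every x ∈ ℝ. -/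
open Real MeasureTheory Set

open Filter Topology

section OrderParameter

variable {G : ℝ → ℝ}

/-- The order-parameter equation in differential form: `G'(x) = e^{-G(-x)}`. -/
lemma hasDerivAt_of_orderParameter (hG : Continuous G)
    (hint : ∀ x : ℝ, IntegrableOn (fun y => Real.exp (-G y)) (Ioi (-x)))
    (hGeq : ∀ x : ℝ, G x = ∫ y in Ioi (-x), Real.exp (-G y)) (x : ℝ) :
    HasDerivAt G (Real.exp (-G (-x))) x := by
  have hc : Continuous fun y => Real.exp (-G y) := by fun_prop
  have hF : ∀ x, G x = G 0 - ∫ y in (0 : ℝ)..(-x), Real.exp (-G y) := by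
    intro x
    have h := intervalIntegral.integral_Ioi_sub_Ioi' (by simpa using hint 0) (hint x)
    have h0 := hGeq 0
    rw [neg_zero] at h0
    rw [← h, ← h0, ← hGeq x]
    ring
  have hd : HasDerivAt (fun u => ∫ y in (0 : ℝ)..u, Real.exp (-G y)) (Real.exp (-G (-x))) (-x) :=
    intervalIntegral.integral_hasDerivAt_right (hc.intervalIntegrable _ _)
      hc.aestronglyMeasurable.stronglyMeasurableAtFilter hc.continuousAt
  have h := (hd.comp x (hasDerivAt_neg x)).const_sub (G 0)
  exact (h.congr_of_eventuallyEq (Eventually.of_forall hF)).congr_deriv (by ring)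

lemma tendsto_atBot_zero_of_orderParameter
    (hint : ∀ x : ℝ, IntegrableOn (fun y => Real.exp (-G y)) (Ioi (-x)))
    (hGeq : ∀ x : ℝ, G x = ∫ y in Ioi (-x), Real.exp (-G y)) :
    Tendsto G atBot (𝓝 0) := by
  have h := intervalIntegral_tendsto_integral_Ioi 0 (by simpa using hint 0)
    tendsto_neg_atBot_atTop
  have h' := h.const_sub (G 0)
  have h0 := hGeq 0
  rw [neg_zero] at h0
  rw [← h0, sub_self] at h'
  refine h'.congr fun x => ?_
  rw [← intervalIntegral.integral_Ioi_sub_Ioi' (by simpa using hint 0) (hint x), ← h0, ← hGeq x]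
  ring

/-- A positive function with `G'(x) = e^{-G(-x)}` grows at least linearly. -/
lemma tendsto_atTop_of_hasDerivAt_exp_neg
    (hd : ∀ x, HasDerivAt G (Real.exp (-G (-x))) x) :
    Tendsto G atTop atTop := by
  have hmono : Monotone G := monotone_of_deriv_nonneg (fun x => (hd x).differentiableAt)
    fun x => by rw [(hd x).deriv]; positivity
  have hlin : ∀ x, 0 ≤ x → Real.exp (-G 0) * x + G 0 ≤ G x := by
    intro x hx
    have h := (convex_Ici (0 : ℝ)).mul_sub_le_image_sub_of_le_deriv
      (fun y _ => (hd y).continuousAt.continuousWithinAt)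
      (fun y _ => (hd y).differentiableAt.differentiableWithinAt)
      (C := Real.exp (-G 0)) (fun y hy => by
        rw [interior_Ici] at hy
        rw [(hd y).deriv]
        exact Real.exp_le_exp.2 (neg_le_neg (hmono (neg_nonpos.2 (le_of_lt hy)))))
      0 self_mem_Ici x hx hx
    linarith
  refine tendsto_atTop_mono' atTop ((eventually_ge_atTop 0).mono hlin) ?_
  exact tendsto_atTop_add_const_right _ _ (tendsto_id.const_mul_atTop (Real.exp_pos _))

/-- The conserved quantity of `G'(x) = e^{-G(-x)}`. -/
lemma exp_neg_add_exp_neg_comp_neg_eq_one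
    (hd : ∀ x, HasDerivAt G (Real.exp (-G (-x))) x) (hbot : Tendsto G atBot (𝓝 0)) (x : ℝ) :
    Real.exp (-G x) + Real.exp (-G (-x)) = 1 := by
  have hS : ∀ x, HasDerivAt (fun x => Real.exp (-G x) + Real.exp (-G (-x))) 0 x := by
    intro x
    have h1 := (hd x).neg.exp
    have h2 := ((hd (-x)).comp x (hasDerivAt_neg x)).neg.exp
    refine (h1.add h2).congr_deriv ?_
    simp only [Pi.neg_apply, Function.comp_apply, neg_neg]
    ring
  have hconst := is_const_of_deriv_eq_zero (fun x => (hS x).differentiableAt)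
    fun x => (hS x).deriv
  have h1 : Tendsto (fun x => Real.exp (-G x)) atBot (𝓝 1) := by
    simpa [Function.comp_def] using (Real.continuous_exp.tendsto _).comp hbot.neg
  have h2 : Tendsto (fun x => Real.exp (-G (-x))) atBot (𝓝 0) :=
    Real.tendsto_exp_neg_atTop_nhds_zero.comp
      ((tendsto_atTop_of_hasDerivAt_exp_neg hd).comp tendsto_neg_atBot_atTop)
  have h3 := h1.add h2
  rw [add_zero] at h3
  exact tendsto_nhds_unique (tendsto_const_nhds.congr fun y => hconst x y) h3

end OrderParameter

/-- Uniqueness for the matching order-parameter equation: any continuous `G` with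
`G(x) = ∫_{-x}^∞ e^{-G(y)} dy` for all `x` equals `log(1 + e^x)`. -/
theorem matching_order_parameter_unique
    (G : ℝ → ℝ) (hG : Continuous G)
    (hGeq : ∀ x : ℝ,
      IntegrableOn (fun y => Real.exp (-G y)) (Ioi (-x)) ∧
      G x = ∫ y in Ioi (-x), Real.exp (-G y)) :
    ∀ x : ℝ, G x = Real.log (1 + Real.exp x) := by
  have hint := fun x => (hGeq x).1
  have heq := fun x => (hGeq x).2
  have hd := hasDerivAt_of_orderParameter hG hint heq
  have hsum := exp_neg_add_exp_neg_comp_neg_eq_one hd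
    (tendsto_atBot_zero_of_orderParameter hint heq)
  have hK : ∀ x, HasDerivAt (fun x => (Real.exp (G x) - 1) * Real.exp (-x)) 0 x := by
    intro x
    refine (((hd x).exp.sub_const 1).mul (hasDerivAt_neg x).exp).congr_deriv ?_
    have h1 : Real.exp (-G (-x)) = 1 - Real.exp (-G x) := by linarith [hsum x]
    have h2 : Real.exp (G x) * Real.exp (-G x) = 1 := by rw [← Real.exp_add]; simp
    rw [h1]
    linear_combination -Real.exp (-x) * h2
  have hG0 : Real.exp (G 0) = 2 := by
    have h1 := hsum 0
    have h2 : Real.exp (G 0) * Real.exp (-G 0) = 1 := by rw [← Real.exp_add]; simp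
    rw [neg_zero] at h1
    linear_combination 2 * h2 - Real.exp (G 0) * h1
  intro x
  have hconst := is_const_of_deriv_eq_zero (fun x => (hK x).differentiableAt)
    (fun x => (hK x).deriv) x 0
  have hx : Real.exp x * Real.exp (-x) = 1 := by rw [← Real.exp_add]; simp
  simp only [hG0, neg_zero, Real.exp_zero] at hconst
  have hexp : Real.exp (G x) = 1 + Real.exp x := by
    linear_combination Real.exp x * hconst - (Real.exp (G x) - 1) * hx
  rw [← hexp, Real.log_exp]
end

section
/- Fix λ > 0. Define functions A_k, B_k : [−λ/2, λ/2] → ℝ recursively by A_0(x) = 0 and B_0(x) = 1 for all x, and A_{k+1}(x) = exp(−∫_{−x}^{λ/2} B_k(t) dt), B_{k+1}(x) = exp(−∫_{−x}^{λ/2} A_k(t) dt). Then for every k ≥ 0, B_{k+1}(λ/2) − A_{k+1}(λ/2) ≤ λ/(k + 1). -/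
open Real Set

/-- The operator `f ↦ exp (-∫_{-x}^{h} f)` driving the matching recursion. -/
noncomputable def expNegIntegral (h : ℝ) (f : ℝ → ℝ) (x : ℝ) : ℝ :=
  Real.exp (-(∫ t in (-x)..h, f t))

theorem expNegIntegral_neg_self (h : ℝ) (f : ℝ → ℝ) : expNegIntegral h f (-h) = 1 := by
  simp [expNegIntegral]

theorem expNegIntegral_nonneg (h : ℝ) (f : ℝ → ℝ) (x : ℝ) : 0 ≤ expNegIntegral h f x :=
  (Real.exp_pos _).le

theorem hasDerivAt_expNegIntegral (h : ℝ) {f : ℝ → ℝ} (hf : Continuous f) (x : ℝ) :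
    HasDerivAt (expNegIntegral h f) (-(expNegIntegral h f x * f (-x))) x := by
  have hleft : HasDerivAt (fun u => ∫ t in u..h, f t) (-f (-x)) (-x) :=
    intervalIntegral.integral_hasDerivAt_left (hf.intervalIntegrable _ _)
      (hf.stronglyMeasurableAtFilter _ _) hf.continuousAt
  have hexp := (hleft.comp x (hasDerivAt_neg x)).neg.exp
  refine HasDerivAt.congr_deriv hexp ?_
  simp [expNegIntegral]

theorem continuous_expNegIntegral (h : ℝ) {f : ℝ → ℝ} (hf : Continuous f) :
    Continuous (expNegIntegral h f) :=
  continuous_iff_continuousAt.2 fun x => (hasDerivAt_expNegIntegral h hf x).continuousAt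

theorem expNegIntegral_anti {h : ℝ} {f g : ℝ → ℝ} (hf : Continuous f) (hg : Continuous g)
    (hfg : ∀ x ∈ Icc (-h) h, f x ≤ g x) {x : ℝ} (hx : x ∈ Icc (-h) h) :
    expNegIntegral h g x ≤ expNegIntegral h f x := by
  refine Real.exp_le_exp.2 (neg_le_neg ?_)
  refine intervalIntegral.integral_mono_on (by linarith [hx.1]) (hf.intervalIntegrable _ _)
    (hg.intervalIntegrable _ _) fun t ht => hfg t ⟨?_, ht.2⟩
  linarith [ht.1, hx.2]

theorem expNegIntegral_le_one {h : ℝ} {f : ℝ → ℝ}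
    (hf : ∀ x ∈ Icc (-h) h, 0 ≤ f x) {x : ℝ} (hx : x ∈ Icc (-h) h) :
    expNegIntegral h f x ≤ 1 := by
  refine Real.exp_le_one_iff.2 (neg_nonpos.2 ?_)
  refine intervalIntegral.integral_nonneg (by linarith [hx.1]) fun t ht => hf t ⟨?_, ht.2⟩
  linarith [ht.1, hx.2]

theorem expNegIntegral_congr {h : ℝ} {f g : ℝ → ℝ}
    (hfg : ∀ x ∈ Icc (-h) h, f x = g x) {x : ℝ} (hx : x ∈ Icc (-h) h) :
    expNegIntegral h f x = expNegIntegral h g x := by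
  unfold expNegIntegral
  rw [intervalIntegral.integral_congr fun t ht => ?_]
  rw [uIcc_of_le (by linarith [hx.1])] at ht
  exact hfg t ⟨by linarith [ht.1, hx.2], ht.2⟩

/-- The pair of lower and upper iterates of the matching recursion, on the whole line. -/
noncomputable def matchingIterate (h : ℝ) : ℕ → (ℝ → ℝ) × (ℝ → ℝ)
  | 0 => (fun _ => 0, fun _ => 1)
  | k + 1 => (expNegIntegral h (matchingIterate h k).2, expNegIntegral h (matchingIterate h k).1)

theorem continuous_matchingIterate (h : ℝ) (k : ℕ) :
    Continuous (matchingIterate h k).1 ∧ Continuous (matchingIterate h k).2 := by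
  induction k with
  | zero => exact ⟨continuous_const, continuous_const⟩
  | succ k ih => exact ⟨continuous_expNegIntegral h ih.2, continuous_expNegIntegral h ih.1⟩

theorem matchingIterate_fst_nonneg (h : ℝ) (k : ℕ) (x : ℝ) : 0 ≤ (matchingIterate h k).1 x := by
  cases k with
  | zero => exact le_rfl
  | succ k => exact expNegIntegral_nonneg h _ x

theorem matchingIterate_snd_le_one (h : ℝ) (k : ℕ) :
    ∀ x ∈ Icc (-h) h, (matchingIterate h k).2 x ≤ 1 := by
  cases k with
  | zero => exact fun _ _ => le_rfl
  | succ k =>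
    exact fun x hx => expNegIntegral_le_one (fun y _ => matchingIterate_fst_nonneg h k y) hx

theorem matchingIterate_fst_le_snd (h : ℝ) (k : ℕ) :
    ∀ x ∈ Icc (-h) h, (matchingIterate h k).1 x ≤ (matchingIterate h k).2 x := by
  induction k with
  | zero => exact fun _ _ => zero_le_one
  | succ k ih =>
    have hc := continuous_matchingIterate h k
    exact fun x hx => expNegIntegral_anti hc.1 hc.2 ih hx

theorem matchingIterate_mono (h : ℝ) (k : ℕ) :
    ∀ x ∈ Icc (-h) h, (matchingIterate h k).1 x ≤ (matchingIterate h (k + 1)).1 x ∧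
      (matchingIterate h (k + 1)).2 x ≤ (matchingIterate h k).2 x := by
  induction k with
  | zero =>
    exact fun x hx => ⟨matchingIterate_fst_nonneg h 1 x, matchingIterate_snd_le_one h 1 x hx⟩
  | succ k ih =>
    have hc := continuous_matchingIterate h k
    have hc' := continuous_matchingIterate h (k + 1)
    exact fun x hx => ⟨expNegIntegral_anti hc'.2 hc.2 (fun y hy => (ih y hy).2) hx,
      expNegIntegral_anti hc.1 hc'.1 (fun y hy => (ih y hy).1) hx⟩

/-- The endpoint gap is at most the decrease of the integrated gap. -/
theorem matchingIterate_gap_le_integral_sub {h : ℝ} (hh : 0 ≤ h) (k : ℕ) :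
    (matchingIterate h (k + 1)).2 h - (matchingIterate h (k + 1)).1 h ≤
      (∫ x in (-h)..h, ((matchingIterate h k).2 (-x) - (matchingIterate h k).1 x)) -
      ∫ x in (-h)..h,
        ((matchingIterate h (k + 1)).2 (-x) - (matchingIterate h (k + 1)).1 x) := by
  obtain ⟨ha, hb⟩ := continuous_matchingIterate h k
  obtain ⟨ha', hb'⟩ := continuous_matchingIterate h (k + 1)
  have hle_one := matchingIterate_snd_le_one h (k + 1)
  have hle := matchingIterate_fst_le_snd h (k + 1)
  have hmono := matchingIterate_mono h k
  have hda : ∀ x, HasDerivAt (matchingIterate h (k + 1)).1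
      (-((matchingIterate h (k + 1)).1 x * (matchingIterate h k).2 (-x))) x :=
    hasDerivAt_expNegIntegral h hb
  have hdb : ∀ x, HasDerivAt (matchingIterate h (k + 1)).2
      (-((matchingIterate h (k + 1)).2 x * (matchingIterate h k).1 (-x))) x :=
    hasDerivAt_expNegIntegral h ha
  have ha_end : (matchingIterate h (k + 1)).1 (-h) = 1 := expNegIntegral_neg_self h _
  have hb_end : (matchingIterate h (k + 1)).2 (-h) = 1 := expNegIntegral_neg_self h _
  generalize (matchingIterate h k).1 = a at *
  generalize (matchingIterate h k).2 = b at *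
  generalize (matchingIterate h (k + 1)).1 = a' at *
  generalize (matchingIterate h (k + 1)).2 = b' at *
  have hderiv : ∀ x ∈ uIcc (-h) h, HasDerivAt (fun y => -(a' y + b' (-y)))
      (a' x * b (-x) - b' (-x) * a x) x := fun x _ => by
    refine HasDerivAt.congr_deriv
      ((hda x).add ((hdb (-x)).comp x (hasDerivAt_neg x))).neg ?_
    simp only [neg_neg]
    ring
  have hftc := intervalIntegral.integral_eq_sub_of_hasDerivAt hderiv
    (Continuous.intervalIntegrable (by fun_prop) _ _)
  simp only [neg_neg, ha_end, hb_end] at hftc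
  rw [← intervalIntegral.integral_sub (Continuous.intervalIntegrable (by fun_prop) _ _)
    (Continuous.intervalIntegrable (by fun_prop) _ _)]
  calc b' h - a' h = ∫ x in (-h)..h, (a' x * b (-x) - b' (-x) * a x) := by rw [hftc]; ring
    _ ≤ _ := by
      refine intervalIntegral.integral_mono_on (by linarith)
        (Continuous.intervalIntegrable (by fun_prop) _ _)
        (Continuous.intervalIntegrable (by fun_prop) _ _) fun x hx => ?_
      have hx' : -x ∈ Icc (-h) h := ⟨by linarith [hx.2], by linarith [hx.1]⟩
      nlinarith [mul_nonneg (sub_nonneg.2 ((hle x hx).trans (hle_one x hx)))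
          (sub_nonneg.2 (hmono (-x) hx').2),
        mul_nonneg (sub_nonneg.2 (hle_one (-x) hx')) (sub_nonneg.2 (hmono x hx).1)]

theorem integral_matchingIterate_gap_nonneg {h : ℝ} (hh : 0 ≤ h) (k : ℕ) :
    0 ≤ ∫ x in (-h)..h, ((matchingIterate h k).2 (-x) - (matchingIterate h k).1 x) := by
  obtain ⟨ha, hb⟩ := continuous_matchingIterate h k
  rw [intervalIntegral.integral_sub (Continuous.intervalIntegrable (by fun_prop) _ _)
    (ha.intervalIntegrable _ _), intervalIntegral.integral_comp_neg, neg_neg, sub_nonneg]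
  exact intervalIntegral.integral_mono_on (by linarith) (ha.intervalIntegrable _ _)
    (hb.intervalIntegrable _ _) (matchingIterate_fst_le_snd h k)

theorem mul_matchingIterate_gap_le {h : ℝ} (hh : 0 ≤ h) (k : ℕ) :
    k * ((matchingIterate h k).2 h - (matchingIterate h k).1 h) ≤
      2 * h - ∫ x in (-h)..h, ((matchingIterate h k).2 (-x) - (matchingIterate h k).1 x) := by
  induction k with
  | zero => simp [matchingIterate]; linarith
  | succ k ih =>
    have hstep := matchingIterate_gap_le_integral_sub hh k
    have hmono := matchingIterate_mono h k h ⟨by linarith, le_rfl⟩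
    have hmul := mul_le_mul_of_nonneg_left (sub_le_sub hmono.2 hmono.1) (Nat.cast_nonneg (α := ℝ) k)
    push_cast
    linarith

/-- Key estimate for the diluted matching recursion on the PWIT:
`B_{k+1}(λ/2) - A_{k+1}(λ/2) ≤ λ/(k+1)`. -/
theorem matching_recursion_gap_bound
    (lam : ℝ) (hlam : 0 < lam)
    (A B : ℕ → ℝ → ℝ)
    (hA0 : ∀ x ∈ Icc (-(lam / 2)) (lam / 2), A 0 x = 0)
    (hB0 : ∀ x ∈ Icc (-(lam / 2)) (lam / 2), B 0 x = 1)
    (hA : ∀ k : ℕ, ∀ x ∈ Icc (-(lam / 2)) (lam / 2),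
      A (k + 1) x = Real.exp (-(∫ t in (-x)..(lam / 2), B k t)))
    (hB : ∀ k : ℕ, ∀ x ∈ Icc (-(lam / 2)) (lam / 2),
      B (k + 1) x = Real.exp (-(∫ t in (-x)..(lam / 2), A k t))) :
    ∀ k : ℕ, B (k + 1) (lam / 2) - A (k + 1) (lam / 2) ≤ lam / (k + 1) := by
  have heq : ∀ k : ℕ, ∀ x ∈ Icc (-(lam / 2)) (lam / 2),
      A k x = (matchingIterate (lam / 2) k).1 x ∧ B k x = (matchingIterate (lam / 2) k).2 x := by
    intro k
    induction k with
    | zero => exact fun x hx => ⟨hA0 x hx, hB0 x hx⟩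
    | succ k ih =>
      exact fun x hx =>
        ⟨(hA k x hx).trans (expNegIntegral_congr (fun y hy => (ih y hy).2) hx),
          (hB k x hx).trans (expNegIntegral_congr (fun y hy => (ih y hy).1) hx)⟩
  intro k
  have hh : 0 ≤ lam / 2 := by positivity
  obtain ⟨hAk, hBk⟩ := heq (k + 1) (lam / 2) ⟨by linarith, le_rfl⟩
  have hgap := mul_matchingIterate_gap_le hh (k + 1)
  have hnonneg := integral_matchingIterate_gap_nonneg hh (k + 1)
  rw [hAk, hBk, le_div_iff₀ (by positivity)]
  push_cast at hgap
  linarith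
end

section
/- Fix λ > 0. Define functions A_k, B_k : [−λ/2, λ/2] → ℝ recursively by A_0(x) = 0 and B_0(x) = 1 for all x, and A_{k+1}(x) = exp(−∫_{−x}^{λ/2} B_k(t) dt), B_{k+1}(x) = exp(−∫_{−x}^{λ/2} A_k(t) dt). Then for every k ≥ 0 and every x ∈ [−λ/2, λ/2], A_k(x) ≤ A_{k+1}(x) ≤ B_{k+1}(x) ≤ B_k(x). -/
open Real Set

/-- The map `x ↦ exp (-∫_{-x}^{c} f)` preserves continuity on `[-c, c]`. -/
theorem continuousOn_exp_neg_integral_neg {c : ℝ} (hc : 0 < c) {f g : ℝ → ℝ}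
    (hf : ContinuousOn f (Icc (-c) c))
    (hg : ∀ x ∈ Icc (-c) c, g x = Real.exp (-(∫ t in (-x)..c, f t))) :
    ContinuousOn g (Icc (-c) c) := by
  have hI : uIcc (-c) c = Icc (-c) c := uIcc_of_le (by linarith)
  have hprim : ContinuousOn (fun x => ∫ t in x..c, f t) (Icc (-c) c) := by
    rw [← hI]
    refine intervalIntegral.continuousOn_primitive_interval_left ?_
    rw [hI]
    exact hf.integrableOn_Icc
  have hneg : MapsTo (fun x : ℝ => -x) (Icc (-c) c) (Icc (-c) c) :=
    fun x hx => ⟨by linarith [hx.2], by linarith [hx.1]⟩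
  exact (Real.continuous_exp.comp_continuousOn
    (hprim.comp continuous_neg.continuousOn hneg).neg).congr hg

/-- The map `f ↦ exp (-∫_{-x}^{c} f)` is antitone on continuous functions. -/
theorem exp_neg_integral_neg_le {c : ℝ} {f g : ℝ → ℝ}
    (hf : ContinuousOn f (Icc (-c) c)) (hg : ContinuousOn g (Icc (-c) c))
    (hfg : ∀ x ∈ Icc (-c) c, f x ≤ g x) {x : ℝ} (hx : x ∈ Icc (-c) c) :
    Real.exp (-(∫ t in (-x)..c, g t)) ≤ Real.exp (-(∫ t in (-x)..c, f t)) := by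
  have hle : -x ≤ c := by linarith [hx.1]
  have hsub : Icc (-x) c ⊆ Icc (-c) c := Icc_subset_Icc_left (by linarith [hx.2])
  refine Real.exp_le_exp.2 (neg_le_neg ?_)
  exact intervalIntegral.integral_mono_on hle
    ((hf.mono hsub).intervalIntegrable_of_Icc hle)
    ((hg.mono hsub).intervalIntegrable_of_Icc hle) fun t ht => hfg t (hsub ht)

/-- Pointwise interlacing `A_k ≤ A_{k+1} ≤ B_{k+1} ≤ B_k` for the diluted
matching recursion on the PWIT. -/
theorem matching_recursion_interlacing
    (lam : ℝ) (hlam : 0 < lam)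
    (A B : ℕ → ℝ → ℝ)
    (hA0 : ∀ x ∈ Icc (-(lam / 2)) (lam / 2), A 0 x = 0)
    (hB0 : ∀ x ∈ Icc (-(lam / 2)) (lam / 2), B 0 x = 1)
    (hA : ∀ k : ℕ, ∀ x ∈ Icc (-(lam / 2)) (lam / 2),
      A (k + 1) x = Real.exp (-(∫ t in (-x)..(lam / 2), B k t)))
    (hB : ∀ k : ℕ, ∀ x ∈ Icc (-(lam / 2)) (lam / 2),
      B (k + 1) x = Real.exp (-(∫ t in (-x)..(lam / 2), A k t))) :
    ∀ k : ℕ, ∀ x ∈ Icc (-(lam / 2)) (lam / 2),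
      A k x ≤ A (k + 1) x ∧ A (k + 1) x ≤ B (k + 1) x ∧ B (k + 1) x ≤ B k x := by
  have hc : 0 < lam / 2 := by linarith
  have hcont : ∀ k, ContinuousOn (A k) (Icc (-(lam / 2)) (lam / 2)) ∧
      ContinuousOn (B k) (Icc (-(lam / 2)) (lam / 2)) := by
    intro k
    induction k with
    | zero => exact ⟨continuousOn_const.congr hA0, continuousOn_const.congr hB0⟩
    | succ k ih =>
      exact ⟨continuousOn_exp_neg_integral_neg hc ih.2 (hA k),
        continuousOn_exp_neg_integral_neg hc ih.1 (hB k)⟩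
  intro k
  induction k with
  | zero =>
    intro x hx
    refine ⟨?_, ?_, ?_⟩
    · rw [hA0 x hx, hA 0 x hx]
      exact (Real.exp_pos _).le
    · rw [hA 0 x hx, hB 0 x hx]
      refine exp_neg_integral_neg_le (hcont 0).1 (hcont 0).2 (fun t ht => ?_) hx
      rw [hA0 t ht, hB0 t ht]
      exact zero_le_one
    · have hzero := exp_neg_integral_neg_le (f := fun _ => 0) continuousOn_const (hcont 0).1
        (fun t ht => (hA0 t ht).ge) hx
      rw [hB0 x hx, hB 0 x hx]
      simpa using hzero
  | succ k ih =>
    intro x hx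
    refine ⟨?_, ?_, ?_⟩
    · rw [hA k x hx, hA (k + 1) x hx]
      exact exp_neg_integral_neg_le (hcont _).2 (hcont _).2 (fun t ht => (ih t ht).2.2) hx
    · rw [hA (k + 1) x hx, hB (k + 1) x hx]
      exact exp_neg_integral_neg_le (hcont _).1 (hcont _).2 (fun t ht => (ih t ht).2.1) hx
    · rw [hB k x hx, hB (k + 1) x hx]
      exact exp_neg_integral_neg_le (hcont _).1 (hcont _).1 (fun t ht => (ih t ht).1) hx
end

section
/- Fix λ > 0. Define functions A_k, B_k : [−λ/2, λ/2] → ℝ recursively by A_0(x) = 0 and B_0(x) = 1 for all x, and A_{k+1}(x) = exp(−∫_{−x}^{λ/2} B_k(t) dt), B_{k+1}(x) = exp(−∫_{−x}^{λ/2} A_k(t) dt). Then for every k ≥ 0, ∫_{−λ/2}^{λ/2} (B_k(t) − A_k(t)) dt ≤ λ·e^λ/(k + 1). -/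
open Real Set

/-- The map `f ↦ (x ↦ exp (-∫_{-x}^{L} f))`, on functions defined on the whole line. -/
noncomputable def expTail (L : ℝ) (f : ℝ → ℝ) (x : ℝ) : ℝ :=
  Real.exp (-(∫ t in (-x)..L, f t))

/-- Global version of the recursion: the pair `(A k, B k)` as functions on the whole line. -/
noncomputable def matchingPair (L : ℝ) : ℕ → (ℝ → ℝ) × (ℝ → ℝ)
  | 0 => (fun _ => 0, fun _ => 1)
  | k + 1 => (expTail L (matchingPair L k).2, expTail L (matchingPair L k).1)

/-- The integral gap `∫_{-L}^{L} (B k - A k)`. -/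
noncomputable def matchingGap (L : ℝ) (k : ℕ) : ℝ :=
  (∫ t in (-L)..L, (matchingPair L k).2 t) - ∫ t in (-L)..L, (matchingPair L k).1 t

theorem hasDerivAt_expTail {L : ℝ} {f : ℝ → ℝ} (hf : Continuous f) (x : ℝ) :
    HasDerivAt (expTail L f) (-(f (-x) * expTail L f x)) x := by
  have h1 : HasDerivAt (fun u => ∫ t in u..L, f t) (-f (-x)) (-x) :=
    intervalIntegral.integral_hasDerivAt_left (hf.intervalIntegrable _ _)
      (hf.stronglyMeasurableAtFilter _ _) hf.continuousAt
  have h2 := ((h1.comp x (hasDerivAt_neg x)).neg).exp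
  refine h2.congr_deriv ?_
  simp only [expTail, Function.comp, Pi.neg_apply]
  ring

theorem continuous_expTail {L : ℝ} {f : ℝ → ℝ} (hf : Continuous f) :
    Continuous (expTail L f) :=
  continuous_iff_continuousAt.2 fun x => (hasDerivAt_expTail hf x).continuousAt

theorem expTail_neg_self (L : ℝ) (f : ℝ → ℝ) : expTail L f (-L) = 1 := by
  simp [expTail]

theorem expTail_pos (L : ℝ) (f : ℝ → ℝ) (x : ℝ) : 0 < expTail L f x :=
  Real.exp_pos _

theorem expTail_anti {L : ℝ} {f g : ℝ → ℝ} (hf : Continuous f) (hg : Continuous g)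
    (hfg : ∀ x ∈ Icc (-L) L, f x ≤ g x) {x : ℝ} (hx : x ∈ Icc (-L) L) :
    expTail L g x ≤ expTail L f x := by
  apply Real.exp_le_exp.2
  apply neg_le_neg
  refine intervalIntegral.integral_mono_on (by linarith [hx.1]) (hf.intervalIntegrable _ _)
    (hg.intervalIntegrable _ _) fun t ht => hfg t ⟨?_, ht.2⟩
  linarith [hx.2, ht.1]

theorem expTail_le_one {L : ℝ} {f : ℝ → ℝ} (hf : Continuous f)
    (h0 : ∀ x ∈ Icc (-L) L, 0 ≤ f x) {x : ℝ} (hx : x ∈ Icc (-L) L) : expTail L f x ≤ 1 := by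
  simpa [expTail] using expTail_anti continuous_const hf h0 hx

theorem integral_expTail_mul_sub {L : ℝ} {f : ℝ → ℝ} (hf : Continuous f) :
    ∫ x in (-L)..L, expTail L f (-x) * (expTail L (expTail L f) x - f x) =
      expTail L f L - expTail L (expTail L f) L := by
  have hg := continuous_expTail (L := L) hf
  have hc := continuous_expTail (L := L) hg
  have hd : ∀ x, HasDerivAt (fun x => -expTail L (expTail L f) x - expTail L f (-x))
      (expTail L f (-x) * (expTail L (expTail L f) x - f x)) x := by
    intro x
    have h1 := hasDerivAt_expTail (L := L) hg x
    have h2 := (hasDerivAt_expTail (L := L) hf (-x)).comp x (hasDerivAt_neg x)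
    refine (h1.neg.sub h2).congr_deriv ?_
    rw [neg_neg x]
    ring
  rw [intervalIntegral.integral_eq_sub_of_hasDerivAt (fun x _ => hd x)
    (Continuous.intervalIntegrable (by fun_prop) _ _)]
  simp only [expTail_neg_self, neg_neg]
  ring

theorem exp_neg_mul_sub_le {u v M : ℝ} (huv : u ≤ v) (hv : v ≤ M) :
    Real.exp (-M) * (v - u) ≤ Real.exp (-u) - Real.exp (-v) := by
  have h1 : Real.exp (-M) ≤ Real.exp (-v) := Real.exp_le_exp.2 (by linarith)
  have h2 : Real.exp (-u) = Real.exp (-v) * Real.exp (v - u) := by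
    rw [← Real.exp_add]; ring_nf
  have h3 := Real.add_one_le_exp (v - u)
  nlinarith [Real.exp_pos (-v), mul_le_mul_of_nonneg_left h3 (Real.exp_pos (-v)).le]

theorem integral_le_of_le_one {L : ℝ} (hL : 0 ≤ L) {f : ℝ → ℝ} (hf : Continuous f)
    (h1 : ∀ x ∈ Icc (-L) L, f x ≤ 1) : ∫ x in (-L)..L, f x ≤ 2 * L := by
  have := intervalIntegral.integral_mono_on (by linarith : -L ≤ L) (hf.intervalIntegrable _ _)
    (continuous_const.intervalIntegrable (μ := MeasureTheory.volume) _ _) h1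
  simp only [intervalIntegral.integral_const, smul_eq_mul] at this
  linarith

theorem integral_expTail_mul_le {L : ℝ} (hL : 0 ≤ L) {f g : ℝ → ℝ} (hf : Continuous f)
    (hf0 : ∀ x ∈ Icc (-L) L, 0 ≤ f x) (hg : Continuous g)
    (hg0 : ∀ x ∈ Icc (-L) L, 0 ≤ g x) :
    ∫ x in (-L)..L, expTail L f (-x) * g x ≤ ∫ x in (-L)..L, g x := by
  have hT := continuous_expTail (L := L) hf
  refine intervalIntegral.integral_mono_on (by linarith)
    (Continuous.intervalIntegrable (by fun_prop) _ _) (hg.intervalIntegrable _ _) fun x hx => ?_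
  exact mul_le_of_le_one_left (hg0 x hx)
    (expTail_le_one hf hf0 ⟨by linarith [hx.2], by linarith [hx.1]⟩)

theorem integral_gap_le_lower_increment {L : ℝ} (hL : 0 ≤ L) {f : ℝ → ℝ} (hf : Continuous f)
    (hf0 : ∀ x ∈ Icc (-L) L, 0 ≤ f x) (hfT : ∀ x ∈ Icc (-L) L, f x ≤ expTail L f x)
    (hfTT : ∀ x ∈ Icc (-L) L, f x ≤ expTail L (expTail L f) x) :
    Real.exp (-(2 * L)) * ((∫ x in (-L)..L, expTail L f x) - ∫ x in (-L)..L, f x) ≤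
      (∫ x in (-L)..L, expTail L (expTail L f) x) - ∫ x in (-L)..L, f x := by
  have hg := continuous_expTail (L := L) hf
  have hc := continuous_expTail (L := L) hg
  have h1 := exp_neg_mul_sub_le
    (intervalIntegral.integral_mono_on (by linarith) (hf.intervalIntegrable (-L) L)
      (hg.intervalIntegrable _ _) hfT)
    (integral_le_of_le_one hL hg fun x hx => expTail_le_one hf hf0 hx)
  have h2 := integral_expTail_mul_le hL hf hf0 (hc.sub hf) fun x hx => sub_nonneg.2 (hfTT x hx)
  simp only [Pi.sub_apply] at h2
  rw [integral_expTail_mul_sub hf,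
    intervalIntegral.integral_sub (hc.intervalIntegrable _ _) (hf.intervalIntegrable _ _)] at h2
  exact h1.trans h2

theorem integral_gap_le_upper_decrement {L : ℝ} (hL : 0 ≤ L) {f : ℝ → ℝ} (hf : Continuous f)
    (hf0 : ∀ x ∈ Icc (-L) L, 0 ≤ f x) (hf1 : ∀ x ∈ Icc (-L) L, f x ≤ 1)
    (hfT : ∀ x ∈ Icc (-L) L, expTail L f x ≤ f x)
    (hfTT : ∀ x ∈ Icc (-L) L, expTail L (expTail L f) x ≤ f x) :
    Real.exp (-(2 * L)) * ((∫ x in (-L)..L, f x) - ∫ x in (-L)..L, expTail L f x) ≤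
      (∫ x in (-L)..L, f x) - ∫ x in (-L)..L, expTail L (expTail L f) x := by
  have hg := continuous_expTail (L := L) hf
  have hc := continuous_expTail (L := L) hg
  have h1 := exp_neg_mul_sub_le
    (intervalIntegral.integral_mono_on (by linarith) (hg.intervalIntegrable (-L) L)
      (hf.intervalIntegrable _ _) hfT)
    (integral_le_of_le_one hL hf hf1)
  have h2 := integral_expTail_mul_le hL hf hf0 (hf.sub hc) fun x hx => sub_nonneg.2 (hfTT x hx)
  have h3 := integral_expTail_mul_sub (L := L) hf
  have h4 : ∫ x in (-L)..L, expTail L f (-x) * (f - expTail L (expTail L f)) x =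
      expTail L (expTail L f) L - expTail L f L := by
    rw [← neg_sub (expTail L f L), ← h3, ← intervalIntegral.integral_neg]
    congr 1
    ext x
    simp only [Pi.sub_apply]
    ring
  rw [h4] at h2
  simp only [Pi.sub_apply] at h2
  rw [intervalIntegral.integral_sub (hf.intervalIntegrable _ _) (hc.intervalIntegrable _ _)] at h2
  exact h1.trans h2

theorem continuous_matchingPair (L : ℝ) (k : ℕ) :
    Continuous (matchingPair L k).1 ∧ Continuous (matchingPair L k).2 := by
  induction k with
  | zero => exact ⟨continuous_const, continuous_const⟩
  | succ k ih => exact ⟨continuous_expTail ih.2, continuous_expTail ih.1⟩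

theorem matchingPair_bounds (L : ℝ) (k : ℕ) : ∀ x ∈ Icc (-L) L,
    0 ≤ (matchingPair L k).1 x ∧ (matchingPair L k).1 x ≤ (matchingPair L k).2 x ∧
      (matchingPair L k).2 x ≤ 1 := by
  induction k with
  | zero => intro x _; simp [matchingPair]
  | succ k ih =>
    obtain ⟨ha, hb⟩ := continuous_matchingPair L k
    intro x hx
    exact ⟨(expTail_pos _ _ _).le, expTail_anti ha hb (fun y hy => (ih y hy).2.1) hx,
      expTail_le_one ha (fun y hy => (ih y hy).1) hx⟩

theorem matchingPair_mono_succ (L : ℝ) (k : ℕ) : ∀ x ∈ Icc (-L) L,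
    (matchingPair L k).1 x ≤ (matchingPair L (k + 1)).1 x ∧
      (matchingPair L (k + 1)).2 x ≤ (matchingPair L k).2 x := by
  induction k with
  | zero =>
    intro x hx
    exact ⟨(matchingPair_bounds L 1 x hx).1, (matchingPair_bounds L 1 x hx).2.2⟩
  | succ k ih =>
    obtain ⟨ha, hb⟩ := continuous_matchingPair L k
    obtain ⟨ha', hb'⟩ := continuous_matchingPair L (k + 1)
    intro x hx
    exact ⟨expTail_anti hb' hb (fun y hy => (ih y hy).2) hx,
      expTail_anti ha ha' (fun y hy => (ih y hy).1) hx⟩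

theorem integral_matchingPair_mono_succ {L : ℝ} (hL : 0 ≤ L) (k : ℕ) :
    (∫ t in (-L)..L, (matchingPair L k).1 t) ≤ ∫ t in (-L)..L, (matchingPair L (k + 1)).1 t ∧
      (∫ t in (-L)..L, (matchingPair L (k + 1)).2 t) ≤
        ∫ t in (-L)..L, (matchingPair L k).2 t := by
  obtain ⟨ha, hb⟩ := continuous_matchingPair L k
  obtain ⟨ha', hb'⟩ := continuous_matchingPair L (k + 1)
  exact ⟨intervalIntegral.integral_mono_on (by linarith) (ha.intervalIntegrable _ _)
      (ha'.intervalIntegrable _ _) fun x hx => (matchingPair_mono_succ L k x hx).1,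
    intervalIntegral.integral_mono_on (by linarith) (hb'.intervalIntegrable _ _)
      (hb.intervalIntegrable _ _) fun x hx => (matchingPair_mono_succ L k x hx).2⟩

theorem matchingGap_nonneg {L : ℝ} (hL : 0 ≤ L) (k : ℕ) : 0 ≤ matchingGap L k := by
  obtain ⟨ha, hb⟩ := continuous_matchingPair L k
  exact sub_nonneg.2 (intervalIntegral.integral_mono_on (by linarith) (ha.intervalIntegrable _ _)
      (hb.intervalIntegrable _ _) fun x hx => (matchingPair_bounds L k x hx).2.1)

theorem matchingGap_zero (L : ℝ) : matchingGap L 0 = 2 * L := by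
  simp [matchingGap, matchingPair]
  ring

theorem matchingGap_antitone {L : ℝ} (hL : 0 ≤ L) : Antitone (matchingGap L) := by
  refine antitone_nat_of_succ_le fun k => ?_
  have := integral_matchingPair_mono_succ hL k
  unfold matchingGap
  linarith

theorem matchingGap_one_le {L : ℝ} (hL : 0 ≤ L) :
    matchingGap L 1 ≤ 2 * L * (1 - Real.exp (-(2 * L))) := by
  obtain ⟨ha, hb⟩ := continuous_matchingPair L 1
  have h1 := integral_le_of_le_one hL hb fun x hx => (matchingPair_bounds L 1 x hx).2.2
  have h2 : ∫ _ in (-L)..L, Real.exp (-(2 * L)) ≤ ∫ t in (-L)..L, (matchingPair L 1).1 t := by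
    refine intervalIntegral.integral_mono_on (by linarith)
      (continuous_const.intervalIntegrable _ _) (ha.intervalIntegrable _ _) fun x hx => ?_
    simp only [matchingPair, expTail, intervalIntegral.integral_const, smul_eq_mul, mul_one]
    exact Real.exp_le_exp.2 (by linarith [hx.2])
  simp only [intervalIntegral.integral_const, smul_eq_mul] at h2
  unfold matchingGap
  linarith

theorem matchingGap_add_contract {L : ℝ} (hL : 0 ≤ L) (k : ℕ) :
    matchingGap L (k + 1) + matchingGap L (k + 2) ≤
      (1 - Real.exp (-(2 * L))) * (matchingGap L k + matchingGap L (k + 1)) := by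
  obtain ⟨ha, hb⟩ := continuous_matchingPair L k
  have hbd := matchingPair_bounds L k
  have hbd' := matchingPair_bounds L (k + 1)
  have hm := matchingPair_mono_succ L k
  have hm' := matchingPair_mono_succ L (k + 1)
  have h1 := integral_gap_le_lower_increment hL ha (fun x hx => (hbd x hx).1)
    (fun x hx => (hm x hx).1.trans (hbd' x hx).2.1)
    (fun x hx => (hm x hx).1.trans (hm' x hx).1)
  have h2 := integral_gap_le_upper_decrement hL hb
    (fun x hx => (hbd x hx).1.trans (hbd x hx).2.1) (fun x hx => (hbd x hx).2.2)
    (fun x hx => (hbd' x hx).2.1.trans (hm x hx).2)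
    (fun x hx => (hm' x hx).2.trans (hm x hx).2)
  simp only [matchingGap, matchingPair]
  linarith

theorem mul_sub_le_inv_succ {u n : ℝ} (hn : 0 < n) (h : u ≤ 1 / n) :
    u * (1 - u) ≤ 1 / (n + 1) := by
  have h1 : u * n ≤ 1 := (le_div_iff₀ hn).1 h
  rw [le_div_iff₀ (by linarith)]
  nlinarith [sq_nonneg (u * (n + 1) - 1), sq_nonneg u, sq_nonneg (u * n - 1)]

theorem matchingGap_add_le {L : ℝ} (hL : 0 < L) (n : ℕ) :
    Real.exp (-(2 * L)) * (matchingGap L n + matchingGap L (n + 1)) / (4 * L) ≤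
      1 / ((n : ℝ) + 2) := by
  set q := Real.exp (-(2 * L)) with hq
  have hq0 : 0 < q := Real.exp_pos _
  have hq1 : q ≤ 1 := Real.exp_le_one_iff.2 (by linarith)
  induction n with
  | zero =>
    have h1 := matchingGap_one_le hL.le
    rw [← hq] at h1
    rw [matchingGap_zero, div_le_iff₀ (by linarith)]
    norm_num
    nlinarith [mul_le_mul_of_nonneg_left h1 hq0.le, mul_nonneg hL.le (sq_nonneg (1 - q))]
  | succ n ih =>
    set S := matchingGap L n + matchingGap L (n + 1) with hS
    have hSn : 0 ≤ S := add_nonneg (matchingGap_nonneg hL.le _) (matchingGap_nonneg hL.le _)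
    have hSle : S ≤ 4 * L := by
      have h1 := matchingGap_antitone hL.le (Nat.zero_le n)
      have h2 := matchingGap_antitone hL.le (Nat.zero_le (n + 1))
      rw [matchingGap_zero] at h1 h2
      linarith
    have hu : q * S / (4 * L) ≤ q := by
      rw [div_le_iff₀ (by linarith)]
      exact mul_le_mul_of_nonneg_left hSle hq0.le
    have hu0 : 0 ≤ q * S / (4 * L) := by positivity
    calc q * (matchingGap L (n + 1) + matchingGap L (n + 1 + 1)) / (4 * L)
        ≤ q * ((1 - q) * S) / (4 * L) := by
          gcongr
          exact matchingGap_add_contract hL.le n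
      _ = q * S / (4 * L) * (1 - q) := by ring
      _ ≤ q * S / (4 * L) * (1 - q * S / (4 * L)) := by gcongr
      _ ≤ 1 / ((n : ℝ) + 2 + 1) := mul_sub_le_inv_succ (by positivity) ih
      _ = 1 / (((n + 1 : ℕ) : ℝ) + 2) := by push_cast; ring

theorem matchingGap_le {L : ℝ} (hL : 0 < L) (k : ℕ) :
    matchingGap L k ≤ 2 * L * Real.exp (2 * L) / (k + 1) := by
  cases k with
  | zero =>
    rw [matchingGap_zero]
    have := Real.one_le_exp (by linarith : 0 ≤ 2 * L)
    norm_num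
    exact le_mul_of_one_le_right (by linarith) this
  | succ n =>
    have h1 := matchingGap_add_le hL n
    have h2 := matchingGap_antitone hL.le n.le_succ
    rw [Real.exp_neg, div_le_div_iff₀ (by linarith) (by positivity)] at h1
    have he := Real.exp_pos (2 * L)
    rw [inv_mul_eq_div, div_mul_eq_mul_div, div_le_iff₀ he] at h1
    rw [le_div_iff₀ (by positivity)]
    push_cast
    nlinarith [mul_le_mul_of_nonneg_right h2 (by positivity : (0 : ℝ) ≤ n + 2)]

theorem eqOn_matchingPair {L : ℝ} {A B : ℕ → ℝ → ℝ}
    (hA0 : ∀ x ∈ Icc (-L) L, A 0 x = 0) (hB0 : ∀ x ∈ Icc (-L) L, B 0 x = 1)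
    (hA : ∀ k : ℕ, ∀ x ∈ Icc (-L) L, A (k + 1) x = Real.exp (-(∫ t in (-x)..L, B k t)))
    (hB : ∀ k : ℕ, ∀ x ∈ Icc (-L) L, B (k + 1) x = Real.exp (-(∫ t in (-x)..L, A k t)))
    (k : ℕ) :
    EqOn (A k) (matchingPair L k).1 (Icc (-L) L) ∧
      EqOn (B k) (matchingPair L k).2 (Icc (-L) L) := by
  have tail_congr : ∀ {f g : ℝ → ℝ}, EqOn f g (Icc (-L) L) → ∀ x ∈ Icc (-L) L,
      ∫ t in (-x)..L, f t = ∫ t in (-x)..L, g t := by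
    intro f g hfg x hx
    refine intervalIntegral.integral_congr fun t ht => ?_
    rw [uIcc_of_le (by linarith [hx.1])] at ht
    exact hfg ⟨by linarith [hx.2, ht.1], ht.2⟩
  induction k with
  | zero => exact ⟨hA0, hB0⟩
  | succ k ih =>
    refine ⟨fun x hx => ?_, fun x hx => ?_⟩
    · rw [hA k x hx, tail_congr ih.2 x hx]
      rfl
    · rw [hB k x hx, tail_congr ih.1 x hx]
      rfl

/-- Theorem 1 of the paper (analytic content):
`∫_{-λ/2}^{λ/2} (B_k - A_k) ≤ λ e^λ/(k+1)` for the diluted matching recursion. -/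
theorem matching_recursion_integral_gap_bound
    (lam : ℝ) (hlam : 0 < lam)
    (A B : ℕ → ℝ → ℝ)
    (hA0 : ∀ x ∈ Icc (-(lam / 2)) (lam / 2), A 0 x = 0)
    (hB0 : ∀ x ∈ Icc (-(lam / 2)) (lam / 2), B 0 x = 1)
    (hA : ∀ k : ℕ, ∀ x ∈ Icc (-(lam / 2)) (lam / 2),
      A (k + 1) x = Real.exp (-(∫ t in (-x)..(lam / 2), B k t)))
    (hB : ∀ k : ℕ, ∀ x ∈ Icc (-(lam / 2)) (lam / 2),
      B (k + 1) x = Real.exp (-(∫ t in (-x)..(lam / 2), A k t))) :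
    ∀ k : ℕ,
      (∫ t in (-(lam / 2))..(lam / 2), B k t - A k t)
        ≤ lam * Real.exp lam / (k + 1) := by
  intro k
  obtain ⟨hAk, hBk⟩ := eqOn_matchingPair hA0 hB0 hA hB k
  obtain ⟨ha, hb⟩ := continuous_matchingPair (lam / 2) k
  have h := matchingGap_le (half_pos hlam) k
  rw [mul_div_cancel₀ lam two_ne_zero] at h
  refine le_of_eq_of_le ?_ h
  rw [matchingGap, ← intervalIntegral.integral_sub (hb.intervalIntegrable _ _)
    (ha.intervalIntegrable _ _)]
  refine intervalIntegral.integral_congr fun t ht => ?_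
  rw [uIcc_of_le (by linarith)] at ht
  simp only [hAk ht, hBk ht]
end

section
/- Fix λ > 0 and let F : ℝ → ℝ be continuous and satisfy F(x) = exp(−∫_{−x}^{λ/2} F(t) dt) for every x ∈ [−λ/2, λ/2]. Set q = F(λ/2). Then for every x ∈ [−λ/2, λ/2], F(x) = (1 + q)/(1 + e^{(1+q)x}), and moreover λ = −2·log q/(1 + q). -/
open Real Set

/-- A function whose derivative vanishes at every point of a convex set is constant on it. -/
lemma Convex.eq_of_forall_hasDerivAt_zero {s : Set ℝ} (hs : Convex ℝ s) {h : ℝ → ℝ}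
    (hh : ∀ x ∈ s, HasDerivAt h 0 x) {x y : ℝ} (hx : x ∈ s) (hy : y ∈ s) : h x = h y := by
  have := hs.norm_image_sub_le_of_norm_hasDerivWithin_le (C := 0)
    (fun z hz => (hh z hz).hasDerivWithinAt) (by simp) hy hx
  rw [zero_mul, norm_le_zero_iff] at this
  exact sub_eq_zero.mp this

lemma hasDerivAt_exp_neg_integral_neg_left {F : ℝ → ℝ} (hF : Continuous F) (a x : ℝ) :
    HasDerivAt (fun y => Real.exp (-(∫ t in (-y)..a, F t)))
      (-(Real.exp (-(∫ t in (-x)..a, F t)) * F (-x))) x := by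
  have h1 : HasDerivAt (fun u => ∫ t in u..a, F t) (-F (-x)) (-x) :=
    intervalIntegral.integral_hasDerivAt_left (hF.intervalIntegrable _ _)
      (hF.stronglyMeasurableAtFilter _ _) hF.continuousAt
  refine (h1.comp x (hasDerivAt_neg x)).neg.exp.congr_deriv ?_
  simp

/-- Explicit form of the limit distribution function for diluted matching:
if `F(x) = exp(-∫_{-x}^{λ/2} F(t) dt)` on `[-λ/2, λ/2]` then, with `q = F(λ/2)`,
`F(x) = (1+q)/(1+e^{(1+q)x})` on `[-λ/2, λ/2]` and `λ = -2 log q/(1+q)`. -/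
theorem matching_limit_distribution_explicit
    (lam : ℝ) (hlam : 0 < lam)
    (F : ℝ → ℝ) (hF : Continuous F)
    (hFeq : ∀ x ∈ Icc (-(lam / 2)) (lam / 2),
      F x = Real.exp (-(∫ t in (-x)..(lam / 2), F t))) :
    (∀ x ∈ Icc (-(lam / 2)) (lam / 2),
        F x = (1 + F (lam / 2)) / (1 + Real.exp ((1 + F (lam / 2)) * x))) ∧
    lam = -2 * Real.log (F (lam / 2)) / (1 + F (lam / 2)) := by
  set a := lam / 2 with ha
  have ha0 : 0 < a := by positivity
  -- `G` extends `F` differentiably beyond the interval, so no one-sided derivatives are needed.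
  obtain ⟨G, hGdef⟩ : ∃ G : ℝ → ℝ, G = fun y => Real.exp (-(∫ t in (-y)..a, F t)) := ⟨_, rfl⟩
  have hGpos (x : ℝ) : 0 < G x := by rw [hGdef]; positivity
  have hFG : ∀ x ∈ Icc (-a) a, F x = G x := by rw [hGdef]; exact hFeq
  have hG' (x : ℝ) : HasDerivAt G (-(G x * F (-x))) x := by
    rw [hGdef]; exact hasDerivAt_exp_neg_integral_neg_left hF a x
  have hneg {x : ℝ} (hx : x ∈ Icc (-a) a) : -x ∈ Icc (-a) a :=
    ⟨by linarith [hx.2], by linarith [hx.1]⟩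
  have hGn' (x : ℝ) : HasDerivAt (fun y => G (-y)) (G (-x) * F x) x := by
    refine ((hG' (-x)).comp x (hasDerivAt_neg x)).congr_deriv ?_
    simp
  have ha_mem : a ∈ Icc (-a) a := ⟨by linarith, le_rfl⟩
  have h0_mem : (0 : ℝ) ∈ Icc (-a) a := ⟨by linarith, ha0.le⟩
  have hGa : G (-a) = 1 := by simp [hGdef]
  set q := F a with hq
  have hqG : q = G a := hFG a ha_mem
  have hqpos : 0 < q := hqG ▸ hGpos a
  have hsum {x : ℝ} (hx : x ∈ Icc (-a) a) : G x + G (-x) = 1 + q := by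
    have := (convex_Icc (-a) a).eq_of_forall_hasDerivAt_zero
      (h := fun y => G y + G (-y)) (fun z hz => by
        refine ((hG' z).add (hGn' z)).congr_deriv ?_
        rw [hFG z hz, hFG (-z) (hneg hz)]; ring) hx ha_mem
    simp only [hGa, ← hqG] at this
    linarith
  have hratio {x : ℝ} (hx : x ∈ Icc (-a) a) : G (-x) = G x * Real.exp ((1 + q) * x) := by
    have := (convex_Icc (-a) a).eq_of_forall_hasDerivAt_zero
      (h := fun y => G (-y) / (G y * Real.exp ((1 + q) * y))) (fun z hz => by
        have he : HasDerivAt (fun y => Real.exp ((1 + q) * y))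
            (Real.exp ((1 + q) * z) * ((1 + q) * 1)) z :=
          ((hasDerivAt_id z).const_mul (1 + q)).exp
        refine ((hGn' z).div ((hG' z).mul he)
          (mul_pos (hGpos z) (Real.exp_pos _)).ne').congr_deriv ?_
        rw [hFG z hz, hFG (-z) (hneg hz), ← hsum hz]
        simp only [Pi.mul_apply]
        ring) hx h0_mem
    simp only [neg_zero, mul_zero, Real.exp_zero, mul_one, div_self (hGpos 0).ne'] at this
    exact (div_eq_one_iff_eq (mul_pos (hGpos x) (Real.exp_pos _)).ne').mp this
  refine ⟨fun x hx => ?_, ?_⟩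
  · rw [hFG x hx, eq_div_iff (by positivity)]
    linarith [hsum hx, hratio hx]
  · have h1 := hratio ha_mem
    rw [hGa, ← hqG] at h1
    have h2 := congrArg Real.log h1
    rw [Real.log_one, Real.log_mul hqpos.ne' (Real.exp_pos _).ne', Real.log_exp] at h2
    rw [eq_div_iff (by positivity)]
    linarith [show lam * (1 + q) = 2 * ((1 + q) * a) by rw [ha]; ring]
end

section
/- Fix λ > 0 and let F : ℝ → ℝ be continuous and satisfy F(x) = exp(−∫_{−x}^{λ/2} F(t) dt) for every x ∈ [−λ/2, λ/2]. Then for every x ∈ [−λ/2, λ/2], F(x) + F(−x) = 1 + F(λ/2). -/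
open Real Set

/-- The right-hand side of the fixed-point equation is differentiable, by the fundamental
theorem of calculus. -/
lemma hasDerivAt_exp_neg_integral_neg {F : ℝ → ℝ} (hF : Continuous F) (a x : ℝ) :
    HasDerivAt (fun x => Real.exp (-(∫ t in (-x)..a, F t)))
      (-(Real.exp (-(∫ t in (-x)..a, F t)) * F (-x))) x := by
  have hI : HasDerivAt (fun u => ∫ t in u..a, F t) (-F (-x)) (-x) :=
    intervalIntegral.integral_hasDerivAt_left (hF.intervalIntegrable _ _)
      (hF.stronglyMeasurableAtFilter _ _) hF.continuousAt
  refine ((hI.comp x (hasDerivAt_neg x)).neg).exp.congr_deriv ?_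
  simp only [Pi.neg_apply, Function.comp_apply]
  ring

/-- Conserved quantity for the diluted matching fixed-point equation:
`F(x) + F(-x) = 1 + F(λ/2)` on `[-λ/2, λ/2]`. -/
theorem matching_limit_distribution_conserved
    (lam : ℝ) (hlam : 0 < lam)
    (F : ℝ → ℝ) (hF : Continuous F)
    (hFeq : ∀ x ∈ Icc (-(lam / 2)) (lam / 2),
      F x = Real.exp (-(∫ t in (-x)..(lam / 2), F t))) :
    ∀ x ∈ Icc (-(lam / 2)) (lam / 2), F x + F (-x) = 1 + F (lam / 2) := by
  have hneg : ∀ x ∈ Icc (-(lam / 2)) (lam / 2), -x ∈ Icc (-(lam / 2)) (lam / 2) :=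
    fun x hx => ⟨neg_le_neg hx.2, neg_le.mp hx.1⟩
  have hleft : -(lam / 2) ∈ Icc (-(lam / 2)) (lam / 2) := ⟨le_rfl, by linarith⟩
  have hone : F (-(lam / 2)) = 1 := by rw [hFeq _ hleft]; simp
  let G : ℝ → ℝ := fun x => Real.exp (-(∫ t in (-x)..(lam / 2), F t))
  have hFG : ∀ x ∈ Icc (-(lam / 2)) (lam / 2), F x = G x := hFeq
  have hGd (x : ℝ) : HasDerivAt G (-(G x * F (-x))) x :=
    hasDerivAt_exp_neg_integral_neg hF _ x
  have hsum (x : ℝ) : HasDerivAt (fun y => G y + G (-y))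
      (-(G x * F (-x)) + G (-x) * F x) x := by
    refine ((hGd x).add ((hGd (-x)).comp x (hasDerivAt_neg x))).congr_deriv ?_
    rw [neg_neg]
    ring
  have hconst := constant_of_has_deriv_right_zero
    (f := fun y => G y + G (-y)) (a := -(lam / 2)) (b := lam / 2)
    (fun x _ => (hsum x).continuousAt.continuousWithinAt)
    (fun x hx => by
      have hx' := Ico_subset_Icc_self hx
      have h0 : -(G x * F (-x)) + G (-x) * F x = 0 := by
        rw [hFG x hx', hFG (-x) (hneg x hx')]
        ring
      exact h0 ▸ (hsum x).hasDerivWithinAt)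
  intro x hx
  have h : G x + G (-x) = G (-(lam / 2)) + G (-(-(lam / 2))) := hconst x hx
  rw [← hFG x hx, ← hFG _ (hneg x hx), ← hFG _ hleft, ← hFG _ (hneg _ hleft), hone,
    neg_neg] at h
  exact h
end

section
/- Fix λ > 0. Define functions A_k, B_k : [−λ/2, λ/2] → ℝ recursively by A_0(x) = 0 and B_0(x) = 1 for all x, and, writing a_k(x) = ∫_{−x}^{λ/2} A_k(t) dt and b_k(x) = ∫_{−x}^{λ/2} B_k(t) dt, by A_{k+1}(x) = (1 + b_k(x))·exp(−b_k(x)) and B_{k+1}(x) = (1 + a_k(x))·exp(−a_k(x)). Then for every k ≥ 0, b_k(λ/2) − a_k(λ/2) ≤ e^λ/(k + 1). -/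
open Real Set

/-- The probability that a Poisson variable of mean `u` is at most one. -/
noncomputable def poissonLeOne (u : ℝ) : ℝ := (1 + u) * Real.exp (-u)

/-- The primitive of `poissonLeOne` vanishing at `0`. -/
noncomputable def poissonLeOnePrimitive (u : ℝ) : ℝ := 2 - (2 + u) * Real.exp (-u)

lemma continuous_poissonLeOne : Continuous poissonLeOne := by
  unfold poissonLeOne; fun_prop

lemma poissonLeOne_zero : poissonLeOne 0 = 1 := by simp [poissonLeOne]

lemma poissonLeOne_pos {u : ℝ} (hu : 0 ≤ u) : 0 < poissonLeOne u := by
  unfold poissonLeOne; positivity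

lemma poissonLeOne_le_of_le {u v : ℝ} (hu : 0 ≤ u) (huv : u ≤ v) :
    poissonLeOne v ≤ poissonLeOne u := by
  have h1 : Real.exp (-u) = Real.exp (v - u) * Real.exp (-v) := by
    rw [← Real.exp_add]; ring_nf
  have h2 := Real.add_one_le_exp (v - u)
  have h3 : 1 + v ≤ (1 + u) * Real.exp (v - u) := by
    nlinarith [mul_nonneg hu (sub_nonneg.2 huv)]
  unfold poissonLeOne
  rw [h1, ← mul_assoc]
  gcongr

lemma poissonLeOne_le_one {u : ℝ} (hu : 0 ≤ u) : poissonLeOne u ≤ 1 :=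
  poissonLeOne_zero ▸ poissonLeOne_le_of_le le_rfl hu

lemma hasDerivAt_poissonLeOnePrimitive (u : ℝ) :
    HasDerivAt poissonLeOnePrimitive (poissonLeOne u) u := by
  have h := (((hasDerivAt_id' u).const_add 2).mul (hasDerivAt_id' u).neg.exp).const_sub 2
  refine h.congr_deriv ?_
  simp only [poissonLeOne, Pi.neg_apply]
  ring

lemma continuous_poissonLeOnePrimitive : Continuous poissonLeOnePrimitive := by
  unfold poissonLeOnePrimitive; fun_prop

lemma mul_sub_le_poissonLeOnePrimitive_sub {u v w : ℝ} (hu : 0 ≤ u) (huv : u ≤ v) (hvw : v ≤ w) :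
    poissonLeOne w * (v - u) ≤ poissonLeOnePrimitive v - poissonLeOnePrimitive u := by
  rcases huv.eq_or_lt with rfl | huv
  · simp
  obtain ⟨x, hx, h⟩ := exists_hasDerivAt_eq_slope poissonLeOnePrimitive poissonLeOne huv
    continuous_poissonLeOnePrimitive.continuousOn
    fun x _ => hasDerivAt_poissonLeOnePrimitive x
  rw [eq_div_iff (sub_pos.2 huv).ne'] at h
  rw [← h]
  exact mul_le_mul_of_nonneg_right
    (poissonLeOne_le_of_le (hu.trans hx.1.le) (hx.2.le.trans hvw)) (sub_pos.2 huv).le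

lemma continuousOn_integral_left {a b : ℝ} (hab : a ≤ b) {f : ℝ → ℝ}
    (hf : ContinuousOn f (Icc a b)) :
    ContinuousOn (fun y => ∫ t in y..b, f t) (Icc a b) := by
  have h := intervalIntegral.continuousOn_primitive_interval_left
    (μ := MeasureTheory.volume) (f := f) (a := a) (b := b)
    (by rw [uIcc_of_le hab]; exact hf.integrableOn_Icc)
  rwa [uIcc_of_le hab] at h

lemma integral_mul_poissonLeOne_integral {a b : ℝ} (hab : a ≤ b) {f : ℝ → ℝ}
    (hf : ContinuousOn f (Icc a b)) :
    ∫ y in a..b, f y * poissonLeOne (∫ t in y..b, f t)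
      = poissonLeOnePrimitive (∫ t in a..b, f t) := by
  have hc := continuousOn_integral_left hab hf
  have key := intervalIntegral.integral_eq_sub_of_hasDerivAt_of_le
    (f := fun y => -poissonLeOnePrimitive (∫ t in y..b, f t))
    (f' := fun y => f y * poissonLeOne (∫ t in y..b, f t)) hab
    (continuous_poissonLeOnePrimitive.comp_continuousOn hc).neg ?_ ?_
  · rw [key]; simp [poissonLeOnePrimitive]
  · intro y hy
    have hd : HasDerivAt (fun y => ∫ t in y..b, f t) (-f y) y := by
      apply intervalIntegral.integral_hasDerivAt_left
      · exact (hf.mono (Icc_subset_Icc hy.1.le le_rfl)).intervalIntegrable_of_Icc hy.2.le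
      · exact (hf.mono Ioo_subset_Icc_self).stronglyMeasurableAtFilter isOpen_Ioo y hy
      · exact hf.continuousAt (Icc_mem_nhds hy.1 hy.2)
    have h := ((hasDerivAt_poissonLeOnePrimitive (∫ t in y..b, f t)).comp y hd).neg
    exact h.congr_deriv (by ring)
  · exact (hf.mul (continuous_poissonLeOne.comp_continuousOn hc)).intervalIntegrable_of_Icc hab

lemma continuousOn_comp_neg_Icc {h : ℝ} {f : ℝ → ℝ} (hf : ContinuousOn f (Icc (-h) h)) :
    ContinuousOn (fun x => f (-x)) (Icc (-h) h) :=
  hf.comp continuousOn_neg fun _ hx => ⟨neg_le_neg hx.2, neg_le.1 hx.1⟩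

lemma continuousOn_of_eq_poissonLeOne {h : ℝ} (hh : 0 ≤ h) {f F : ℝ → ℝ}
    (hf : ContinuousOn f (Icc (-h) h))
    (hF : ∀ x ∈ Icc (-h) h, F x = poissonLeOne (∫ t in (-x)..h, f t)) :
    ContinuousOn F (Icc (-h) h) :=
  (continuous_poissonLeOne.comp_continuousOn (continuousOn_comp_neg_Icc
    (continuousOn_integral_left (neg_le_self hh) hf))).congr hF

/-- The gap contracts by at least the factor `1 - poissonLeOne w` in one step of the recursion,
where `w` bounds the total mass of the upper function. -/
lemma poissonLeOne_mul_gap_le {h w : ℝ} (hh : 0 ≤ h) {f g F G : ℝ → ℝ}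
    (hf : ContinuousOn f (Icc (-h) h)) (hg : ContinuousOn g (Icc (-h) h))
    (hF : ∀ x ∈ Icc (-h) h, F x = poissonLeOne (∫ t in (-x)..h, g t))
    (hG : ∀ x ∈ Icc (-h) h, G x = poissonLeOne (∫ t in (-x)..h, f t))
    (hf0 : ∀ x ∈ Icc (-h) h, 0 ≤ f x) (hfg : ∀ x ∈ Icc (-h) h, f x ≤ g x)
    (hg1 : ∀ x ∈ Icc (-h) h, g x ≤ 1)
    (hfF : ∀ x ∈ Icc (-h) h, f x ≤ F x) (hGg : ∀ x ∈ Icc (-h) h, G x ≤ g x)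
    (hw : ∫ t in (-h)..h, g t ≤ w) :
    poissonLeOne w * ((∫ t in (-h)..h, g t) - ∫ t in (-h)..h, f t)
      ≤ ((∫ t in (-h)..h, g t) - ∫ t in (-h)..h, f t)
        - ((∫ t in (-h)..h, G t) - ∫ t in (-h)..h, F t) := by
  have hle : -h ≤ h := neg_le_self hh
  have hneg : ∀ x ∈ Icc (-h) h, -x ∈ Icc (-h) h :=
    fun _ hx => ⟨neg_le_neg hx.2, neg_le.1 hx.1⟩
  have hFc := continuousOn_of_eq_poissonLeOne hh hg hF
  have hGc := continuousOn_of_eq_poissonLeOne hh hf hG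
  have hfn := continuousOn_comp_neg_Icc hf
  have hFn := continuousOn_comp_neg_Icc hFc
  have hfi := hf.intervalIntegrable_of_Icc (μ := MeasureTheory.volume) hle
  have hgi := hg.intervalIntegrable_of_Icc (μ := MeasureTheory.volume) hle
  have hGi := hGc.intervalIntegrable_of_Icc (μ := MeasureTheory.volume) hle
  have hfni := hfn.intervalIntegrable_of_Icc (μ := MeasureTheory.volume) hle
  have hFni := hFn.intervalIntegrable_of_Icc (μ := MeasureTheory.volume) hle
  have hgF : ∫ y in (-h)..h, g y * F (-y) = poissonLeOnePrimitive (∫ t in (-h)..h, g t) := by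
    rw [← integral_mul_poissonLeOne_integral hle hg]
    refine intervalIntegral.integral_congr fun y hy => ?_
    rw [uIcc_of_le hle] at hy
    simp only [hF _ (hneg y hy), neg_neg]
  have hfG : ∫ y in (-h)..h, f (-y) * G y = poissonLeOnePrimitive (∫ t in (-h)..h, f t) := by
    rw [← integral_mul_poissonLeOne_integral hle hf]
    have hflip := intervalIntegral.integral_comp_neg (a := -h) (b := h)
      (fun y => f y * G (-y))
    simp only [neg_neg] at hflip
    rw [hflip]
    refine intervalIntegral.integral_congr fun y hy => ?_
    rw [uIcc_of_le hle] at hy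
    simp only [hG _ (hneg y hy), neg_neg]
  have hf_neg : ∫ y in (-h)..h, f (-y) = ∫ y in (-h)..h, f y := by simp
  have hF_neg : ∫ y in (-h)..h, F (-y) = ∫ y in (-h)..h, F y := by simp
  have hgFi : IntervalIntegrable (fun y => g y * F (-y)) MeasureTheory.volume (-h) h :=
    (hg.mul hFn).intervalIntegrable_of_Icc hle
  have hfGi : IntervalIntegrable (fun y => f (-y) * G y) MeasureTheory.volume (-h) h :=
    (hfn.mul hGc).intervalIntegrable_of_Icc hle
  have hmono : ∫ y in (-h)..h, (g y * F (-y) - f (-y) * G y)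
      ≤ ∫ y in (-h)..h, ((F (-y) - f (-y)) + (g y - G y)) := by
    refine intervalIntegral.integral_mono_on hle
      (hgFi.sub hfGi)
      ((hFni.sub hfni).add (hgi.sub hGi)) fun y hy => ?_
    have hy' := hneg y hy
    nlinarith [mul_nonneg (sub_nonneg.2 (hg1 y hy)) (sub_nonneg.2 (hfF _ hy')),
      mul_nonneg (sub_nonneg.2 ((hfg _ hy').trans (hg1 _ hy'))) (sub_nonneg.2 (hGg y hy))]
  rw [intervalIntegral.integral_sub hgFi hfGi,
    intervalIntegral.integral_add (hFni.sub hfni) (hgi.sub hGi),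
    intervalIntegral.integral_sub hFni hfni, intervalIntegral.integral_sub hgi hGi,
    hgF, hfG, hf_neg, hF_neg] at hmono
  have hslope := mul_sub_le_poissonLeOnePrimitive_sub
    (intervalIntegral.integral_nonneg hle hf0)
    (intervalIntegral.integral_mono_on hle hfi hgi hfg) hw
  linarith

/-- Convergence estimate for the comply-constrain (TSP) recursion on the PWIT:
with `a_k(x) = ∫_{-x}^{λ/2} A_k`, `b_k(x) = ∫_{-x}^{λ/2} B_k`, one has
`b_k(λ/2) - a_k(λ/2) ≤ e^λ/(k+1)`. -/
theorem tsp_recursion_gap_bound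
    (lam : ℝ) (hlam : 0 < lam)
    (A B : ℕ → ℝ → ℝ)
    (hA0 : ∀ x ∈ Icc (-(lam / 2)) (lam / 2), A 0 x = 0)
    (hB0 : ∀ x ∈ Icc (-(lam / 2)) (lam / 2), B 0 x = 1)
    (hA : ∀ k : ℕ, ∀ x ∈ Icc (-(lam / 2)) (lam / 2),
      A (k + 1) x = (1 + ∫ t in (-x)..(lam / 2), B k t)
        * Real.exp (-(∫ t in (-x)..(lam / 2), B k t)))
    (hB : ∀ k : ℕ, ∀ x ∈ Icc (-(lam / 2)) (lam / 2),
      B (k + 1) x = (1 + ∫ t in (-x)..(lam / 2), A k t)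
        * Real.exp (-(∫ t in (-x)..(lam / 2), A k t))) :
    ∀ k : ℕ,
      (∫ t in (-(lam / 2))..(lam / 2), B k t)
          - (∫ t in (-(lam / 2))..(lam / 2), A k t)
        ≤ Real.exp lam / (k + 1) := by

  intro k
  have hh : 0 ≤ lam / 2 := by positivity
  generalize hhdef : lam / 2 = h at *
  have hlam2 : lam = h - -h := by linarith
  have hle : -h ≤ h := neg_le_self hh
  have hcont : ∀ k, ContinuousOn (A k) (Icc (-h) h) ∧ ContinuousOn (B k) (Icc (-h) h) := by
    intro k
    induction k with
    | zero => exact ⟨continuousOn_const.congr hA0, continuousOn_const.congr hB0⟩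
    | succ k ih =>
      exact ⟨continuousOn_of_eq_poissonLeOne hh ih.2 (hA k),
        continuousOn_of_eq_poissonLeOne hh ih.1 (hB k)⟩
  have htail : ∀ {f : ℝ → ℝ}, ContinuousOn f (Icc (-h) h) → ∀ x ∈ Icc (-h) h,
      IntervalIntegrable f MeasureTheory.volume (-x) h := fun hf x hx =>
    (hf.mono (Icc_subset_Icc (neg_le_neg hx.2) le_rfl)).intervalIntegrable_of_Icc (neg_le.1 hx.1)
  have hpos : ∀ {f : ℝ → ℝ}, (∀ x ∈ Icc (-h) h, 0 ≤ f x) → ∀ x ∈ Icc (-h) h,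
      0 ≤ ∫ t in (-x)..h, f t := fun hf x hx =>
    intervalIntegral.integral_nonneg (neg_le.1 hx.1) fun t ht =>
      hf t ⟨(neg_le_neg hx.2).trans ht.1, ht.2⟩
  have hmono : ∀ {f g : ℝ → ℝ}, ContinuousOn f (Icc (-h) h) → ContinuousOn g (Icc (-h) h) →
      (∀ x ∈ Icc (-h) h, f x ≤ g x) → ∀ x ∈ Icc (-h) h,
      ∫ t in (-x)..h, f t ≤ ∫ t in (-x)..h, g t := fun hf hg hfg x hx =>
    intervalIntegral.integral_mono_on (neg_le.1 hx.1) (htail hf x hx) (htail hg x hx)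
      fun t ht => hfg t ⟨(neg_le_neg hx.2).trans ht.1, ht.2⟩
  have hA' : ∀ k, ∀ x ∈ Icc (-h) h, A (k + 1) x = poissonLeOne (∫ t in (-x)..h, B k t) := hA
  have hB' : ∀ k, ∀ x ∈ Icc (-h) h, B (k + 1) x = poissonLeOne (∫ t in (-x)..h, A k t) := hB
  have horder : ∀ k, (∀ x ∈ Icc (-h) h, 0 ≤ A k x) ∧ (∀ x ∈ Icc (-h) h, A k x ≤ B k x) ∧
      (∀ x ∈ Icc (-h) h, B k x ≤ 1) := by
    intro k
    induction k with
    | zero =>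
      refine ⟨fun x hx => (hA0 x hx).ge, fun x hx => ?_, fun x hx => (hB0 x hx).le⟩
      rw [hA0 x hx, hB0 x hx]; exact zero_le_one
    | succ k ih =>
      obtain ⟨h0, h1, -⟩ := ih
      refine ⟨fun x hx => ?_, fun x hx => ?_, fun x hx => ?_⟩
      · rw [hA' k x hx]
        exact (poissonLeOne_pos (hpos (fun y hy => (h0 y hy).trans (h1 y hy)) x hx)).le
      · rw [hA' k x hx, hB' k x hx]
        exact poissonLeOne_le_of_le (hpos h0 x hx) (hmono (hcont k).1 (hcont k).2 h1 x hx)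
      · rw [hB' k x hx]
        exact poissonLeOne_le_one (hpos h0 x hx)
  have hstep : ∀ k, (∀ x ∈ Icc (-h) h, A k x ≤ A (k + 1) x) ∧
      (∀ x ∈ Icc (-h) h, B (k + 1) x ≤ B k x) := by
    intro k
    induction k with
    | zero =>
      refine ⟨fun x hx => ?_, fun x hx => ?_⟩
      · rw [hA0 x hx]; exact (horder 1).1 x hx
      · rw [hB0 x hx]; exact (horder 1).2.2 x hx
    | succ k ih =>
      refine ⟨fun x hx => ?_, fun x hx => ?_⟩
      · rw [hA' k x hx, hA' (k + 1) x hx]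
        exact poissonLeOne_le_of_le
          (hpos (fun y hy => ((horder (k + 1)).1 y hy).trans ((horder (k + 1)).2.1 y hy)) x hx)
          (hmono (hcont (k + 1)).2 (hcont k).2 ih.2 x hx)
      · rw [hB' k x hx, hB' (k + 1) x hx]
        exact poissonLeOne_le_of_le (hpos (horder k).1 x hx)
          (hmono (hcont k).1 (hcont (k + 1)).1 ih.1 x hx)
  have hmem : h ∈ Icc (-h) h := right_mem_Icc.2 hle
  have hmass : ∀ k, ∫ t in (-h)..h, B k t ≤ lam := by
    intro k
    have := hmono (hcont k).2 continuousOn_const (horder k).2.2 h hmem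
    rw [intervalIntegral.integral_const, smul_eq_mul, mul_one] at this
    linarith
  set c := poissonLeOne lam with hc
  have hc0 : 0 < c := poissonLeOne_pos hlam.le
  have hc1 : c ≤ 1 := poissonLeOne_le_one hlam.le
  let D : ℕ → ℝ := fun k => (∫ t in (-h)..h, B k t) - ∫ t in (-h)..h, A k t
  have hD0 : ∀ k, 0 ≤ D k := fun k =>
    sub_nonneg.2 (hmono (hcont k).1 (hcont k).2 (horder k).2.1 h hmem)
  have hDstep : ∀ k, c * D k ≤ D k - D (k + 1) := fun k =>
    poissonLeOne_mul_gap_le hh (hcont k).1 (hcont k).2 (hA' k) (hB' k) (horder k).1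
      (horder k).2.1 (horder k).2.2 (hstep k).1 (hstep k).2 (hmass k)
  have hbound : ∀ k : ℕ, c * k * D k + D k ≤ lam := by
    intro k
    induction k with
    | zero =>
      have := hpos (horder 0).1 h hmem
      have := hmass 0
      simp only [D, Nat.cast_zero, mul_zero, zero_mul, zero_add]
      linarith
    | succ k ih =>
      have h1 := hDstep k
      have h2 : D (k + 1) ≤ D k := by nlinarith [mul_nonneg hc0.le (hD0 k)]
      have h3 : c * (k + 1) * D (k + 1) ≤ c * (k + 1) * D k := by gcongr
      push_cast
      linarith
  have hk : (0 : ℝ) < k + 1 := by positivity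
  have hfin : c * (D k * (k + 1)) ≤ lam := by
    nlinarith [hbound k, mul_nonneg (sub_nonneg.2 hc1) (hD0 k)]
  have hexp : c * Real.exp lam = 1 + lam := by
    rw [hc, poissonLeOne, mul_assoc, ← Real.exp_add]; simp
  change D k ≤ _
  rw [le_div_iff₀ hk]
  refine le_of_mul_le_mul_left ?_ hc0
  linarith
end
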